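/- For every real $\epsilon$ with $0 < \epsilon < 1/2$ there exists a constant $C = C(\epsilon) > 0$ such that for every prime $p$ with $p \equiv 1 \pmod{4}$ one has $Q(p, S_4) - \frac{p-1}{8} \ge C\, p^{\frac{1}{2} - \epsilon}$ (as real numbers). -/

import Mathlib

/-- `a` is a quadratic residue modulo `p`: the congruence `x^2 ≡ a (mod p)` has a solution in `ℤ`. -/
def IsQR (p a : ℕ) : Prop := ∃ x : ℤ, x ^ 2 ≡ (a : ℤ) [ZMOD (p : ℤ)]

open Classical in
/-- `Q(p, S_k)`: the number of quadratic residues modulo `p` in `[1, p-1]` that are multiples of `k`. -/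
noncomputable def Qcount (p k : ℕ) : ℕ :=
  ((Finset.Icc 1 (p - 1)).filter fun a => k ∣ a ∧ IsQR p a).card

open Classical in
/-- `N(p, S_k)`: the number of quadratic non-residues modulo `p` in `[1, p-1]` that are multiples of `k`. -/
noncomputable def Ncount (p k : ℕ) : ℕ :=
  ((Finset.Icc 1 (p - 1)).filter fun a => k ∣ a ∧ ¬ IsQR p a).card

open Classical in
/-- `Q(p, 𝒪)`: the number of quadratic residues modulo `p` among the odd integers in `[1, p-1]`. -/
noncomputable def QcountOdd (p : ℕ) : ℕ :=
  ((Finset.Icc 1 (p - 1)).filter fun a => Odd a ∧ IsQR p a).card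

open Classical in
/-- `Q(p, S_2 \ S_4)`: the number of quadratic residues modulo `p` in `[1, p-1]`
divisible by `2` but not by `4`. -/
noncomputable def Qcount2not4 (p : ℕ) : ℕ :=
  ((Finset.Icc 1 (p - 1)).filter fun a => (2 ∣ a ∧ ¬ (4 ∣ a)) ∧ IsQR p a).card


theorem lower_bound_of_coeff_add_nonneg {g : ℕ → ℝ} {l D t G : ℝ} {M : ℕ}
    (h0 : 1 ≤ g 0 + l) (hn : ∀ n, 0 ≤ g n + l) (hg : ∀ n, |g n| ≤ D * (2 / 3) ^ n)
    (ht : 1 < t) (ht' : t ≤ 5 / 4) (hG : HasSum (fun n => g n * t ^ n) G)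
    (hle : G ≤ l / (t - 1)) (hM : 1 ≤ M) (hMD : 6 * D * (5 / 6) ^ M ≤ 1 / 2) :
    (t - 1) / 2 ≤ l * t ^ M := by
  have hD : 0 ≤ D := by simpa using (abs_nonneg _).trans (hg 0)
  have htail : -(1 / 2) ≤ ∑' n, g (n + M) * t ^ (n + M) := by
    have hb : ∀ n, ‖g (n + M) * t ^ (n + M)‖ ≤ D * (5 / 6) ^ M * (5 / 6) ^ n := by
      intro n
      rw [Real.norm_eq_abs, abs_mul, abs_of_pos (by positivity : 0 < t ^ (n + M))]
      calc |g (n + M)| * t ^ (n + M) ≤ D * (2 / 3) ^ (n + M) * (5 / 4) ^ (n + M) := by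
            gcongr
            exact hg _
        _ = D * (5 / 6) ^ M * (5 / 6) ^ n := by
            rw [mul_assoc, ← mul_pow, mul_assoc, ← pow_add, add_comm M n]; norm_num
    have hs : HasSum (fun n : ℕ => D * (5 / 6 : ℝ) ^ M * (5 / 6) ^ n)
        (D * (5 / 6) ^ M * (1 - 5 / 6)⁻¹) :=
      (hasSum_geometric_of_lt_one (by norm_num) (by norm_num)).mul_left _
    have := tsum_of_norm_bounded hs hb
    rw [Real.norm_eq_abs] at this
    have h2 := neg_le_of_abs_le this
    norm_num at h2 hMD ⊢
    linarith
  have hhead : 1 - l * ((t ^ M - 1) / (t - 1)) ≤ ∑ n ∈ Finset.range M, g n * t ^ n := by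
    rw [← geom_sum_eq ht.ne' M, Finset.mul_sum, sub_le_iff_le_add, ← Finset.sum_add_distrib]
    have : ∀ n ∈ Finset.range M, 0 ≤ g n * t ^ n + l * t ^ n := fun n _ => by
      rw [← add_mul]; exact mul_nonneg (hn n) (by positivity)
    refine le_trans ?_ (Finset.single_le_sum this (Finset.mem_range.2 hM))
    simpa using h0
  have hsum := hG.summable.sum_add_tsum_nat_add M
  rw [hG.tsum_eq] at hsum
  have ht0 : 0 < t - 1 := by linarith
  have : 1 / 2 ≤ l * t ^ M / (t - 1) := by
    have e : l * ((t ^ M - 1) / (t - 1)) = l * t ^ M / (t - 1) - l / (t - 1) := by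
      field_simp
    linarith
  rw [le_div_iff₀ ht0] at this
  linarith

theorem iteratedDeriv_const_div_sub_one (c : ℂ) (n : ℕ) :
    iteratedDeriv n (fun s : ℂ => c * (1 * s - 1)⁻¹) 2 = c * ((-1) ^ n * n.factorial) := by
  rw [iteratedDeriv_const_mul]
  · rw [iteratedDeriv_eq_iterate, iter_deriv_inv_linear_sub]
    norm_num
  · exact (by fun_prop : ContDiffAt ℂ n (fun s : ℂ => 1 * s - 1) 2).inv (by norm_num)

open scoped ComplexOrder in
theorem estermann_lower_bound {a : ℕ → ℂ} {K : ℂ → ℂ} {B β : ℝ} (ha : 0 ≤ a) (ha1 : 1 ≤ a 1)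
    (habs : LSeries.abscissaOfAbsConv a ≤ 1) (hK : Differentiable ℂ K)
    (hFK : ∀ s : ℂ, 1 < s.re → LSeries a s = K s / (s - 1)) (hB1 : 1 ≤ B)
    (hB : ∀ z ∈ Metric.sphere (2 : ℂ) (3 / 2), ‖K z‖ ≤ B) (h1 : ‖K 1‖ ≤ B)
    (hβ : 3 / 4 ≤ β) (hβ1 : β < 1) (hneg : (K β / (β - 1)).re ≤ 0) :
    (1 - β) / 2 ≤ (K 1).re * (Real.exp 1 * (48 * B) ^ (6 * (1 - β))) := by
  set G := dslope K 1 with hGdef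
  have hG : Differentiable ℂ G := by
    rw [← differentiableOn_univ]
    exact (Complex.differentiableOn_dslope Filter.univ_mem).2 hK.differentiableOn
  have hGK : ∀ s : ℂ, s ≠ 1 → G s = K s / (s - 1) - K 1 * (1 * s - 1)⁻¹ := by
    intro s hs
    have : s - 1 ≠ 0 := sub_ne_zero.2 hs
    rw [hGdef, dslope_of_ne _ hs, slope_def_field, one_mul]
    field_simp
  have hGB : ∀ z ∈ Metric.sphere (2 : ℂ) (3 / 2), ‖G z‖ ≤ 4 * B := by
    intro z hz
    have hz' : (1 : ℝ) / 2 ≤ ‖z - 1‖ := by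
      have h2 : ‖z - 2‖ = 3 / 2 := by simpa [dist_eq_norm] using hz
      have : ‖z - 2‖ ≤ ‖z - 1‖ + ‖(1 : ℂ)‖ := by
        calc ‖z - 2‖ = ‖(z - 1) - 1‖ := by ring_nf
          _ ≤ _ := norm_sub_le _ _
      rw [norm_one] at this
      linarith
    have hz1 : z ≠ 1 := by
      rintro rfl
      norm_num at hz'
    have hpos : 0 < ‖z - 1‖ := by linarith
    rw [hGdef, dslope_of_ne _ hz1, slope_def_field, norm_div, div_le_iff₀ hpos]
    calc ‖K z - K 1‖ ≤ ‖K z‖ + ‖K 1‖ := norm_sub_le _ _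
      _ ≤ 4 * B * (1 / 2) := by linarith [hB z hz]
      _ ≤ _ := by gcongr
  have hlt : LSeries.abscissaOfAbsConv a < ((2 : ℝ) : EReal) :=
    habs.trans_lt (by exact_mod_cast one_lt_two)
  set g : ℕ → ℝ := fun n => ((n.factorial : ℂ)⁻¹ * ((-1) ^ n * iteratedDeriv n G 2)).re with hg
  have hder : ∀ n : ℕ, (n.factorial : ℂ)⁻¹ * ((-1) ^ n * iteratedDeriv n G 2) + K 1 =
      (n.factorial : ℂ)⁻¹ * ((-1) ^ n * iteratedDeriv n (LSeries a) 2) := by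
    intro n
    have hev : G =ᶠ[nhds 2] fun s => LSeries a s - K 1 * (1 * s - 1)⁻¹ := by
      have : {s : ℂ | 1 < s.re} ∈ nhds (2 : ℂ) :=
        (isOpen_lt continuous_const Complex.continuous_re).mem_nhds (by norm_num)
      filter_upwards [this] with s hs
      have hs' : 1 < s.re := hs
      rw [hGK s (by rintro rfl; simp at hs'), hFK s hs']
    rw [hev.iteratedDeriv_eq, iteratedDeriv_fun_sub, iteratedDeriv_const_div_sub_one]
    · have : ((-1 : ℂ) ^ n) * (-1) ^ n = 1 := by rw [← mul_pow]; norm_num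
      have hf : (n.factorial : ℂ) ≠ 0 := by exact_mod_cast n.factorial_ne_zero
      field_simp
      linear_combination (-(n.factorial : ℂ) * K 1) * this
    · refine ((LSeries_analyticOnNhd a) 2 ?_).contDiffAt
      simpa using hlt
    · exact contDiffAt_const.mul
        ((by fun_prop : ContDiffAt ℂ n (fun s : ℂ => 1 * s - 1) 2).inv (by norm_num))
  have hgl : ∀ n, g n + (K 1).re =
      ((n.factorial : ℂ)⁻¹ * ((-1) ^ n * iteratedDeriv n (LSeries a) 2)).re := by
    intro n
    rw [← hder, Complex.add_re]
  have hn : ∀ n, 0 ≤ g n + (K 1).re := by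
    intro n
    rw [hgl]
    have h := LSeries.iteratedDeriv_alternating ha hlt n
    have h2 : (0 : ℂ) ≤ (n.factorial : ℂ)⁻¹ := by
      rw [← Complex.ofReal_natCast, ← Complex.ofReal_inv]
      exact Complex.zero_le_real.2 (by positivity)
    have := mul_nonneg h2 h
    exact (Complex.nonneg_iff.1 (by simpa using this)).1
  have h0 : 1 ≤ g 0 + (K 1).re := by
    rw [hgl]
    have hs : LSeriesSummable a ((2 : ℝ) : ℂ) :=
      LSeriesSummable_of_abscissaOfAbsConv_lt_re (by simpa using hlt)
    have h := hs.le_tsum 1 (fun n _ => LSeries.term_nonneg (ha n) 2)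
    have h2 : (1 : ℂ) ≤ LSeries a 2 := by
      refine ha1.trans ?_
      simpa [LSeries, LSeries.term_def] using h
    simpa using (Complex.le_def.1 h2).1
  have hgD : ∀ n, |g n| ≤ 4 * B * (2 / 3) ^ n := by
    intro n
    refine (Complex.abs_re_le_norm _).trans ?_
    have := Complex.norm_iteratedDeriv_le_of_forall_mem_sphere_norm_le n (by norm_num)
      hG.diffContOnCl hGB
    have hf : (0 : ℝ) < n.factorial := by exact_mod_cast n.factorial_pos
    rw [norm_mul, norm_mul, norm_pow, norm_neg, norm_one, one_pow, one_mul, norm_inv,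
      Complex.norm_natCast, inv_mul_le_iff₀ hf]
    refine this.trans (le_of_eq ?_)
    rw [mul_div_assoc, mul_div_assoc, div_eq_mul_inv B, ← inv_pow]
    norm_num
    ring_nf
    simp
  have hsum : HasSum (fun n => g n * (2 - β) ^ n) (G β).re := by
    have h := Complex.hasSum_re (Complex.hasSum_taylorSeries_of_entire hG 2 β)
    convert h using 2 with n
    have e : ((β : ℂ) - 2) ^ n = (((2 - β) ^ n : ℝ) : ℂ) * (-1) ^ n := by
      rw [Complex.ofReal_pow, ← mul_pow]
      push_cast
      ring
    rw [smul_eq_mul, smul_eq_mul, e, hg, mul_comm, ← Complex.re_ofReal_mul]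
    congr 1
    ring
  have hle : (G β).re ≤ (K 1).re / ((2 - β) - 1) := by
    have hβc : (β : ℂ) ≠ 1 := by exact_mod_cast hβ1.ne
    have e : K 1 * (1 * (β : ℂ) - 1)⁻¹ = (((β - 1)⁻¹ : ℝ) : ℂ) * K 1 := by
      push_cast
      ring
    rw [hGK _ hβc, Complex.sub_re, e, Complex.re_ofReal_mul]
    have e2 : (K 1).re / (2 - β - 1) = -((β - 1)⁻¹ * (K 1).re) := by
      rw [show 2 - β - 1 = -(β - 1) by ring, div_neg, div_eq_inv_mul]
    rw [e2]
    linarith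
  have hlog : 1 < 48 * B := by linarith
  have hlogpos := Real.log_pos hlog
  set M := ⌈6 * Real.log (48 * B)⌉₊ with hM
  have hMge : 6 * Real.log (48 * B) ≤ M := Nat.le_ceil _
  have hMlt : (M : ℝ) < 6 * Real.log (48 * B) + 1 := Nat.ceil_lt_add_one (by positivity)
  have hMD : 6 * (4 * B) * (5 / 6) ^ M ≤ 1 / 2 := by
    have h65 : (1 : ℝ) / 6 ≤ Real.log (6 / 5) := by
      have := Real.one_sub_inv_le_log_of_pos (by norm_num : (0 : ℝ) < 6 / 5)
      norm_num at this ⊢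
      linarith
    have h : 48 * B ≤ (6 / 5) ^ M := by
      rw [← Real.log_le_log_iff (by linarith) (by positivity), Real.log_pow]
      nlinarith
    have h3 : (5 / 6 : ℝ) ^ M * (6 / 5) ^ M = 1 := by rw [← mul_pow]; norm_num
    have h4 : (0 : ℝ) < (5 / 6) ^ M := by positivity
    nlinarith
  have key := lower_bound_of_coeff_add_nonneg h0 hn hgD (by linarith : 1 < 2 - β) (by linarith)
    hsum hle (Nat.one_le_ceil_iff.2 (by positivity)) hMD
  have hpow : (2 - β) ^ M ≤ Real.exp 1 * (48 * B) ^ (6 * (1 - β)) := by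
    rw [Real.rpow_def_of_pos (by linarith), ← Real.exp_add]
    calc (2 - β) ^ M ≤ Real.exp (1 - β) ^ M := by
          gcongr
          · linarith
          · linarith [Real.add_one_le_exp (1 - β)]
      _ = Real.exp (M * (1 - β)) := (Real.exp_nat_mul _ _).symm
      _ ≤ _ := by
          gcongr
          nlinarith
  have hpos : 0 < (2 - β) ^ M := pow_pos (by linarith) _
  have hK1 : 0 < (K 1).re := by
    by_contra! h
    nlinarith
  calc (1 - β) / 2 = (2 - β - 1) / 2 := by ring
    _ ≤ _ := key
    _ ≤ _ := by gcongr

namespace DirichletCharacter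

variable {N : ℕ} (χ : DirichletCharacter ℂ N)

/-- The partial sum `χ(1) + ⋯ + χ(n)`. -/
noncomputable def partialSum (n : ℕ) : ℂ := ∑ k ∈ Finset.range n, χ ((k + 1 : ℕ) : ZMod N)

/-- The `n`-th term of the series for `L(s, χ)` obtained from summation by parts. -/
noncomputable def abelTerm (s : ℂ) (n : ℕ) : ℂ :=
  χ.partialSum (n + 1) * (((n : ℂ) + 1) ^ (-s) - ((n : ℂ) + 2) ^ (-s))

theorem norm_partialSum_le_self (n : ℕ) : ‖χ.partialSum n‖ ≤ n := by
  calc ‖χ.partialSum n‖ ≤ ∑ k ∈ Finset.range n, ‖χ ((k + 1 : ℕ) : ZMod N)‖ := norm_sum_le _ _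
    _ ≤ ∑ k ∈ Finset.range n, 1 := Finset.sum_le_sum fun k _ => χ.norm_le_one _
    _ = n := by simp

variable [NeZero N] {χ}

theorem sum_range_add_eq_zero (hχ : χ ≠ 1) (j : ℕ) :
    ∑ k ∈ Finset.range N, χ ((k + j : ℕ) : ZMod N) = 0 := by
  induction j with
  | zero =>
    rw [← χ.sum_eq_zero_of_ne_one hχ, Finset.sum_range]
    refine Fintype.sum_equiv (ZMod.finEquiv N).toEquiv _ _ fun x => ?_
    obtain ⟨n, rfl⟩ : ∃ n, N = n + 1 := ⟨N - 1, by have := NeZero.pos N; omega⟩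
    exact congrArg χ (Fin.cast_val_eq_self x)
  | succ j ih =>
    have h := Finset.sum_range_succ' (fun k => χ ((k + j : ℕ) : ZMod N)) N
    rw [Finset.sum_range_succ, ih] at h
    have e : ∀ k, k + (j + 1) = k + 1 + j := by intro k; ring
    simp only [e]
    have : ((N + j : ℕ) : ZMod N) = ((0 + j : ℕ) : ZMod N) := by simp
    rw [this] at h
    exact (add_right_cancel h).symm

theorem partialSum_add_level (hχ : χ ≠ 1) (n : ℕ) : χ.partialSum (n + N) = χ.partialSum n := by
  rw [partialSum, Finset.sum_range_add, partialSum, add_eq_left]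
  have := sum_range_add_eq_zero hχ (n + 1)
  rw [← this]
  refine Finset.sum_congr rfl fun k _ => ?_
  congr 2
  ring

theorem norm_partialSum_le_level (hχ : χ ≠ 1) (n : ℕ) : ‖χ.partialSum n‖ ≤ N := by
  induction n using Nat.strong_induction_on with
  | _ n ih =>
    rcases lt_or_ge n N with h | h
    · exact (χ.norm_partialSum_le_self n).trans (by exact_mod_cast h.le)
    · obtain ⟨m, rfl⟩ := Nat.exists_eq_add_of_le' h
      rw [partialSum_add_level hχ]
      exact ih m (by have := NeZero.pos N; omega)

end DirichletCharacter

theorem norm_cpow_neg_sub_le {s : ℂ} (hs : 0 < s.re) (n : ℕ) :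
    ‖((n : ℂ) + 1) ^ (-s) - ((n : ℂ) + 2) ^ (-s)‖ ≤ ‖s‖ * ((n : ℝ) + 1) ^ (-s.re - 1) := by
  have hs0 : -s ≠ 0 := neg_ne_zero.2 (by rintro rfl; simp at hs)
  have key := Convex.norm_image_sub_le_of_norm_hasDerivWithin_le (𝕜 := ℝ)
    (f := fun x : ℝ => (x : ℂ) ^ (-s)) (f' := fun x : ℝ => -s * (x : ℂ) ^ (-s - 1))
    (s := Set.Icc ((n : ℝ) + 1) (n + 2)) (C := ‖s‖ * ((n : ℝ) + 1) ^ (-s.re - 1))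
    (x := n + 2) (y := n + 1) ?_ ?_ (convex_Icc _ _) ?_ ?_
  · have e : |(1 : ℝ) - 2| = 1 := by norm_num
    simpa [e] using key
  · intro x hx
    have hx0 : 0 < x := lt_of_lt_of_le (by positivity) hx.1
    exact (hasDerivAt_ofReal_cpow_const hx0.ne' hs0).hasDerivWithinAt
  · intro x hx
    have hx0 : 0 < x := lt_of_lt_of_le (by positivity) hx.1
    rw [norm_mul, norm_neg, Complex.norm_cpow_eq_rpow_re_of_pos hx0]
    simp only [Complex.sub_re, Complex.neg_re, Complex.one_re]
    gcongr ?_ * ?_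
    exact Real.rpow_le_rpow_of_nonpos (by positivity) hx.1 (by linarith)
  · constructor <;> linarith
  · constructor <;> linarith

theorem summable_nat_add_one_rpow {x : ℝ} (hx : x < -1) :
    Summable fun n : ℕ => ((n : ℝ) + 1) ^ x := by
  have := (summable_nat_add_iff 1).2 (Real.summable_nat_rpow.2 hx)
  simpa using this

namespace DirichletCharacter

variable {N : ℕ} {χ : DirichletCharacter ℂ N}

theorem sum_range_eq_sum_abelTerm_add (s : ℂ) (M : ℕ) :
    ∑ n ∈ Finset.range M, χ ((n + 1 : ℕ) : ZMod N) * ((n : ℂ) + 1) ^ (-s) =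
      ∑ n ∈ Finset.range M, χ.abelTerm s n + χ.partialSum M * ((M : ℂ) + 1) ^ (-s) := by
  induction M with
  | zero => simp [partialSum]
  | succ M ih =>
    rw [Finset.sum_range_succ, ih, Finset.sum_range_succ, abelTerm, partialSum, partialSum,
      Finset.sum_range_succ]
    push_cast
    ring_nf

variable [NeZero N]

theorem norm_abelTerm_le (hχ : χ ≠ 1) {s : ℂ} (hs : 0 < s.re) (n : ℕ) :
    ‖χ.abelTerm s n‖ ≤ N * ‖s‖ * ((n : ℝ) + 1) ^ (-s.re - 1) := by
  rw [abelTerm, norm_mul, mul_assoc]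
  gcongr
  · exact norm_partialSum_le_level hχ _
  · exact norm_cpow_neg_sub_le hs n

theorem summable_abelTerm (hχ : χ ≠ 1) {s : ℂ} (hs : 0 < s.re) : Summable (χ.abelTerm s) :=
  .of_norm_bounded ((summable_nat_add_one_rpow (by linarith)).mul_left _)
    (norm_abelTerm_le hχ hs)

theorem tendsto_sum_range_tsum_abelTerm (hχ : χ ≠ 1) {s : ℂ} (hs : 0 < s.re) :
    Filter.Tendsto (fun M => ∑ n ∈ Finset.range M,
      χ ((n + 1 : ℕ) : ZMod N) * ((n : ℂ) + 1) ^ (-s)) Filter.atTop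
      (nhds (∑' n, χ.abelTerm s n)) := by
  simp only [sum_range_eq_sum_abelTerm_add]
  rw [← add_zero (∑' n, χ.abelTerm s n)]
  refine (summable_abelTerm hχ hs).hasSum.tendsto_sum_nat.add ?_
  have hb : ∀ M : ℕ, ‖χ.partialSum M * ((M : ℂ) + 1) ^ (-s)‖ ≤ N * ((M : ℝ) + 1) ^ (-s.re) := by
    intro M
    rw [norm_mul]
    gcongr
    · exact norm_partialSum_le_level hχ _
    · have := Complex.norm_cpow_eq_rpow_re_of_pos (by positivity : (0 : ℝ) < M + 1) (-s)
      push_cast at this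
      rw [this, Complex.neg_re]
  refine squeeze_zero_norm hb ?_
  rw [← mul_zero (N : ℝ)]
  refine Filter.Tendsto.const_mul _ ?_
  exact (tendsto_rpow_neg_atTop hs).comp
    (Filter.tendsto_atTop_add_const_right _ 1 tendsto_natCast_atTop_atTop)

theorem differentiableOn_tsum_abelTerm (hχ : χ ≠ 1) :
    DifferentiableOn ℂ (fun s => ∑' n, χ.abelTerm s n) {s | 0 < s.re} := by
  intro s hs
  have hs' : 0 < s.re := hs
  set U : Set ℂ := {z | s.re / 2 < z.re} ∩ Metric.ball 0 (‖s‖ + 1) with hU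
  have hUo : IsOpen U := (isOpen_lt continuous_const Complex.continuous_re).inter Metric.isOpen_ball
  have hsU : s ∈ U := ⟨by simpa using hs', by simp⟩
  refine DifferentiableAt.differentiableWithinAt ?_
  refine DifferentiableOn.differentiableAt ?_ (hUo.mem_nhds hsU)
  refine Complex.differentiableOn_tsum_of_summable_norm
    (u := fun n => N * (‖s‖ + 1) * ((n : ℝ) + 1) ^ (-(s.re / 2) - 1)) ?_ ?_ hUo ?_
  · exact (summable_nat_add_one_rpow (by linarith)).mul_left _
  · intro n z hz
    unfold abelTerm
    refine DifferentiableAt.differentiableWithinAt ?_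
    refine DifferentiableAt.const_mul (DifferentiableAt.sub ?_ ?_) _
    · refine DifferentiableAt.const_cpow (by fun_prop) (Or.inl (by exact_mod_cast n.succ_ne_zero))
    · refine DifferentiableAt.const_cpow (by fun_prop)
        (Or.inl (by exact_mod_cast (n + 1).succ_ne_zero))
  · rintro n z ⟨hz1, hz2⟩
    have hz1' : s.re / 2 < z.re := hz1
    have hz2' : ‖z‖ < ‖s‖ + 1 := by simpa using hz2
    refine (norm_abelTerm_le hχ (by linarith) n).trans ?_
    gcongr
    · linarith [n.cast_nonneg (α := ℝ)]

theorem LFunction_eq_tsum_abelTerm (hχ : χ ≠ 1) {s : ℂ} (hs : 0 < s.re) :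
    LFunction χ s = ∑' n, χ.abelTerm s n := by
  have hUo : IsOpen {s : ℂ | 0 < s.re} := isOpen_lt continuous_const Complex.continuous_re
  have h1 : AnalyticOnNhd ℂ (LFunction χ) {s | 0 < s.re} :=
    (differentiable_LFunction hχ).differentiableOn.analyticOnNhd hUo
  have h2 := (differentiableOn_tsum_abelTerm hχ).analyticOnNhd hUo
  refine h1.eqOn_of_preconnected_of_eventuallyEq h2
    (convex_halfSpace_re_gt 0).isPreconnected (z₀ := 2) (by simp) ?_ hs
  have : {s : ℂ | 1 < s.re} ∈ nhds (2 : ℂ) :=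
    (isOpen_lt continuous_const Complex.continuous_re).mem_nhds (by norm_num)
  filter_upwards [this] with z hz
  have hz' : 1 < z.re := hz
  rw [LFunction_eq_LSeries χ hz']
  have hs : LSeriesSummable (χ ·) z := LSeriesSummable_of_one_lt_re χ hz'
  have ht := ((hasSum_nat_add_iff' 1).2 hs.hasSum).tendsto_sum_nat
  rw [Finset.sum_range_one, LSeries.term_zero, sub_zero] at ht
  refine tendsto_nhds_unique ht ?_
  convert tendsto_sum_range_tsum_abelTerm hχ (by linarith : 0 < z.re) using 1
  · ext M
    refine Finset.sum_congr rfl fun n _ => ?_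
    rw [LSeries.term_of_ne_zero n.succ_ne_zero, Complex.cpow_neg, div_eq_mul_inv]
    push_cast
    rfl

theorem tendsto_sum_range_LFunction (hχ : χ ≠ 1) {s : ℂ} (hs : 0 < s.re) :
    Filter.Tendsto (fun M => ∑ n ∈ Finset.range M,
      χ ((n + 1 : ℕ) : ZMod N) * ((n : ℂ) + 1) ^ (-s)) Filter.atTop (nhds (LFunction χ s)) :=
  LFunction_eq_tsum_abelTerm hχ hs ▸ tendsto_sum_range_tsum_abelTerm hχ hs

end DirichletCharacter

theorem exists_norm_LFunction_le_level : ∃ A : ℝ, 1 ≤ A ∧ ∀ (N : ℕ) [NeZero N]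
    (χ : DirichletCharacter ℂ N), χ ≠ 1 → ∀ s : ℂ, 1 / 2 ≤ s.re → ‖s‖ ≤ 4 →
      ‖χ.LFunction s‖ ≤ A * N := by
  refine ⟨max 1 (4 * ∑' n : ℕ, ((n : ℝ) + 1) ^ (-(3 / 2) : ℝ)), le_max_left _ _, ?_⟩
  intro N _ χ hχ s hs hs4
  rw [χ.LFunction_eq_tsum_abelTerm hχ (by linarith)]
  have hsum : Summable fun n : ℕ => ((n : ℝ) + 1) ^ (-(3 / 2) : ℝ) :=
    summable_nat_add_one_rpow (by norm_num)
  have := tsum_of_norm_bounded (hsum.hasSum.mul_left (N * 4 : ℝ)) (f := χ.abelTerm s) fun n => by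
    refine (χ.norm_abelTerm_le hχ (by linarith) n).trans ?_
    gcongr
    · linarith [n.cast_nonneg (α := ℝ)]
    · linarith
  refine this.trans ?_
  rw [mul_assoc, mul_comm]
  gcongr
  exact le_max_right _ _

theorem exists_norm_LFunction_one_le_rpow {η : ℝ} (hη : 0 < η) (hη1 : η < 1) :
    ∃ A : ℝ, 1 ≤ A ∧ ∀ (N : ℕ) [NeZero N] (χ : DirichletCharacter ℂ N), χ ≠ 1 →
      ‖χ.LFunction 1‖ ≤ A * (N : ℝ) ^ η := by
  refine ⟨max 1 (∑' n : ℕ, ((n : ℝ) + 1) ^ (-1 - η)), le_max_left _ _, ?_⟩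
  intro N _ χ hχ
  rw [χ.LFunction_eq_tsum_abelTerm hχ (by simp)]
  have hsum : Summable fun n : ℕ => ((n : ℝ) + 1) ^ (-1 - η) :=
    summable_nat_add_one_rpow (by linarith)
  have hN : (0 : ℝ) < N := by exact_mod_cast NeZero.pos N
  have := tsum_of_norm_bounded (hsum.hasSum.mul_left ((N : ℝ) ^ η)) (f := χ.abelTerm 1) fun n => by
    have hpos : (0 : ℝ) < n + 1 := by positivity
    have h1 : ‖χ.partialSum (n + 1)‖ ≤ (N : ℝ) ^ η * ((n : ℝ) + 1) ^ (1 - η) := by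
      have h1 := χ.norm_partialSum_le_level hχ (n + 1)
      have h2 := χ.norm_partialSum_le_self (n + 1)
      push_cast at h2
      rcases le_total (N : ℝ) (n + 1) with h | h
      · refine h1.trans ?_
        calc (N : ℝ) = (N : ℝ) ^ η * (N : ℝ) ^ (1 - η) := by
              rw [← Real.rpow_add hN]; simp
          _ ≤ _ := by gcongr
      · refine h2.trans ?_
        calc (n : ℝ) + 1 = ((n : ℝ) + 1) ^ η * ((n : ℝ) + 1) ^ (1 - η) := by
              rw [← Real.rpow_add hpos]; simp
          _ ≤ _ := by gcongr
    have h2 := norm_cpow_neg_sub_le (s := 1) (by simp) n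
    rw [DirichletCharacter.abelTerm, norm_mul]
    refine (mul_le_mul h1 h2 (norm_nonneg _) (by positivity)).trans (le_of_eq ?_)
    rw [norm_one, one_mul, mul_assoc, ← Real.rpow_add hpos]
    congr 2
    simp
  refine this.trans ?_
  rw [mul_comm]
  gcongr
  exact le_max_right _ _

section Nonneg

open ArithmeticFunction
open scoped ComplexOrder

/-- `IsLogDerivative f g` says that `f · log = g * f`, so that the Dirichlet series of `-g` is the
logarithmic derivative of that of `f`. -/
def IsLogDerivative (f g : ArithmeticFunction ℂ) : Prop :=
  ∀ n : ℕ, f n * (Real.log n : ℂ) = (g * f) n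

theorem IsLogDerivative.mul {f f' g g' : ArithmeticFunction ℂ} (h : IsLogDerivative f g)
    (h' : IsLogDerivative f' g') : IsLogDerivative (f * f') (g + g') := by
  intro n
  have e : (g + g') * (f * f') = (g * f) * f' + f * (g' * f') := by ring
  rw [e, ArithmeticFunction.add_apply, ArithmeticFunction.mul_apply, ArithmeticFunction.mul_apply,
    ArithmeticFunction.mul_apply, Finset.sum_mul, ← Finset.sum_add_distrib]
  refine Finset.sum_congr rfl fun x hx => ?_
  obtain ⟨hx1, hn⟩ := Nat.mem_divisorsAntidiagonal.1 hx
  have h1 : x.1 ≠ 0 := by rintro h0; simp [h0] at hx1; exact hn hx1.symm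
  have h2 : x.2 ≠ 0 := by rintro h0; simp [h0] at hx1; exact hn hx1.symm
  rw [← h, ← h', ← hx1, Nat.cast_mul, Real.log_mul (by exact_mod_cast h1) (by exact_mod_cast h2)]
  push_cast
  ring

theorem IsLogDerivative.nonneg {f g : ArithmeticFunction ℂ} (h : IsLogDerivative f g)
    (hf : f 1 = 1) (hg : ∀ n, 0 ≤ g n) (hg1 : g 1 = 0) (n : ℕ) : 0 ≤ f n := by
  induction n using Nat.strong_induction_on with
  | _ n ih =>
    rcases Nat.lt_or_ge n 2 with hn | hn
    · interval_cases n
      · simp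
      · simp [hf]
    · have hlog : 0 < Real.log n := Real.log_pos (by exact_mod_cast hn)
      have hpos : 0 ≤ f n * (Real.log n : ℂ) := by
        rw [h n, ArithmeticFunction.mul_apply]
        refine Finset.sum_nonneg fun x hx => ?_
        obtain ⟨hx1, hn0⟩ := Nat.mem_divisorsAntidiagonal.1 hx
        rcases eq_or_ne x.1 1 with h1 | h1
        · simp [h1, hg1]
        · refine mul_nonneg (hg _) (ih _ ?_)
          have h2 : x.1 ≠ 0 := by rintro h0; simp [h0] at hx1; exact hn0 hx1.symm
          have h3 : x.2 ≠ 0 := by rintro h0; simp [h0] at hx1; exact hn0 hx1.symm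
          rw [← hx1]
          have : 2 ≤ x.1 := by omega
          nlinarith [Nat.pos_of_ne_zero h3]
      have : f n = (f n * (Real.log n : ℂ)) * ((Real.log n)⁻¹ : ℝ) := by
        have : (Real.log n : ℂ) ≠ 0 := by exact_mod_cast hlog.ne'
        rw [Complex.ofReal_inv, mul_assoc, mul_inv_cancel₀ this, mul_one]
      rw [this]
      exact mul_nonneg hpos (Complex.zero_le_real.2 (by positivity))

namespace DirichletCharacter

variable {N : ℕ}

/-- A Dirichlet character as an arithmetic function. -/
noncomputable def coeff (χ : DirichletCharacter ℂ N) : ArithmeticFunction ℂ :=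
  toArithmeticFunction (χ ·)

/-- The arithmetic function `χ · Λ`. -/
noncomputable def twistedLambda (χ : DirichletCharacter ℂ N) : ArithmeticFunction ℂ :=
  toArithmeticFunction (fun n => χ n * (vonMangoldt n : ℂ))

theorem coeff_one (χ : DirichletCharacter ℂ N) : χ.coeff 1 = 1 := by
  simp [coeff, toArithmeticFunction]

theorem twistedLambda_apply (χ : DirichletCharacter ℂ N) (n : ℕ) :
    χ.twistedLambda n = χ n * (vonMangoldt n : ℂ) := by
  rcases eq_or_ne n 0 with rfl | hn
  · simp
  · simp [twistedLambda, toArithmeticFunction, hn]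

theorem isLogDerivative_coeff (χ : DirichletCharacter ℂ N) :
    IsLogDerivative χ.coeff χ.twistedLambda := by
  intro n
  have h := congrFun χ.convolution_twist_vonMangoldt n
  rcases eq_or_ne n 0 with rfl | hn
  · simp
  · have e : χ.coeff n = χ n := by simp [coeff, toArithmeticFunction, hn]
    rw [e, Complex.ofReal_log n.cast_nonneg, Complex.ofReal_natCast]
    exact h.symm

theorem LSeries_coeff (χ : DirichletCharacter ℂ N) (s : ℂ) :
    LSeries χ.coeff s = LSeries (χ ·) s :=
  LSeries_congr (fun {n} hn => by simp [coeff, toArithmeticFunction, hn]) s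

theorem LSeriesSummable_coeff (χ : DirichletCharacter ℂ N) {s : ℂ} (hs : 1 < s.re) :
    LSeriesSummable χ.coeff s :=
  (LSeriesSummable_congr s fun {n} hn => by simp [coeff, toArithmeticFunction, hn]).1
    (LSeriesSummable_of_one_lt_re χ hs)

theorem _root_.abscissaOfAbsConv_le_one_of_forall_LSeriesSummable {a : ℕ → ℂ}
    (h : ∀ s : ℂ, 1 < s.re → LSeriesSummable a s) : LSeries.abscissaOfAbsConv a ≤ 1 :=
  LSeries.abscissaOfAbsConv_le_of_forall_lt_LSeriesSummable (x := 1)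
    fun y hy => h y (by simpa using hy)

theorem _root_.LSeries_coeff_one_modOne {s : ℂ} (hs : 1 < s.re) :
    LSeries (1 : DirichletCharacter ℂ 1).coeff s = riemannZeta s := by
  rw [LSeries_coeff, ← LFunction_eq_LSeries _ hs, LFunction_modOne_eq]

variable {N₁ N₂ : ℕ} {χ : DirichletCharacter ℂ N} {χ₁ : DirichletCharacter ℂ N₁}
  {χ₂ : DirichletCharacter ℂ N₂}

/-- The product of two Dirichlet characters, at the product of their levels. -/
noncomputable def prodChar (χ₁ : DirichletCharacter ℂ N₁) (χ₂ : DirichletCharacter ℂ N₂) :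
    DirichletCharacter ℂ (N₁ * N₂) :=
  changeLevel (dvd_mul_right N₁ N₂) χ₁ * changeLevel (dvd_mul_left N₂ N₁) χ₂

theorem prodChar_apply (χ₁ : DirichletCharacter ℂ N₁) (χ₂ : DirichletCharacter ℂ N₂) (n : ℕ) :
    prodChar χ₁ χ₂ n = χ₁ n * χ₂ n := by
  rw [prodChar, MulChar.mul_apply]
  by_cases h : IsUnit ((n : ℕ) : ZMod (N₁ * N₂))
  · obtain ⟨u, hu⟩ := h
    rw [← hu, changeLevel_eq_cast_of_dvd, changeLevel_eq_cast_of_dvd, hu,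
      ZMod.cast_natCast (dvd_mul_right _ _), ZMod.cast_natCast (dvd_mul_left _ _)]
  · rw [MulChar.map_nonunit _ h, zero_mul]
    rw [ZMod.isUnit_iff_coprime, Nat.coprime_mul_iff_right, not_and_or] at h
    rcases h with h | h <;> rw [← ZMod.isUnit_iff_coprime] at h
    · rw [MulChar.map_nonunit _ h, zero_mul]
    · rw [MulChar.map_nonunit _ h, mul_zero]

theorem _root_.MulChar.IsQuadratic.one_add_nonneg (hχ : χ.IsQuadratic) (a : ZMod N) :
    0 ≤ 1 + χ a := by
  rcases hχ a with h | h | h <;> norm_num [h]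

theorem coeff_mul_coeff_nonneg (hχ : χ.IsQuadratic) (n : ℕ) :
    0 ≤ ((1 : DirichletCharacter ℂ 1).coeff * χ.coeff) n := by
  refine ((isLogDerivative_coeff _).mul (isLogDerivative_coeff χ)).nonneg ?_ ?_ ?_ n
  · simp [coeff_one]
  · intro n
    have h := mul_nonneg (hχ.one_add_nonneg n)
      (Complex.zero_le_real.2 (vonMangoldt_nonneg (n := n)))
    rw [add_mul, one_mul] at h
    have e : (1 : DirichletCharacter ℂ 1) n = 1 := MulChar.one_apply (isUnit_of_subsingleton _)
    simpa [twistedLambda_apply, e] using h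
  · simp [twistedLambda_apply]

theorem coeff_mul_coeff_mul_nonneg (hχ₁ : χ₁.IsQuadratic) (hχ₂ : χ₂.IsQuadratic) (n : ℕ) :
    0 ≤ ((1 : DirichletCharacter ℂ 1).coeff * χ₁.coeff *
      (χ₂.coeff * (prodChar χ₁ χ₂).coeff)) n := by
  refine (((isLogDerivative_coeff _).mul (isLogDerivative_coeff χ₁)).mul
    ((isLogDerivative_coeff χ₂).mul (isLogDerivative_coeff _))).nonneg ?_ ?_ ?_ n
  · simp [coeff_one]
  · intro n
    have h := mul_nonneg (mul_nonneg (hχ₁.one_add_nonneg n) (hχ₂.one_add_nonneg n))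
      (Complex.zero_le_real.2 (vonMangoldt_nonneg (n := n)))
    have e : (1 : DirichletCharacter ℂ 1) n = 1 := MulChar.one_apply (isUnit_of_subsingleton _)
    convert h using 1
    simp only [ArithmeticFunction.add_apply, twistedLambda_apply, prodChar_apply, e]
    ring
  · simp [twistedLambda_apply]

end DirichletCharacter

end Nonneg

namespace DirichletCharacter

variable {N N₁ N₂ : ℕ} [NeZero N] [NeZero N₁] [NeZero N₂] {χ : DirichletCharacter ℂ N}
  {χ₁ : DirichletCharacter ℂ N₁} {χ₂ : DirichletCharacter ℂ N₂}

/-- The entire function `(s - 1) * ζ(s)`. -/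
noncomputable def _root_.zetaMulSubOne : ℂ → ℂ := LFunctionTrivChar₁ 1

theorem _root_.zetaMulSubOne_one : zetaMulSubOne 1 = 1 := by simp [zetaMulSubOne]

theorem _root_.differentiable_zetaMulSubOne : Differentiable ℂ zetaMulSubOne :=
  differentiable_LFunctionTrivChar₁ 1

theorem _root_.zetaMulSubOne_div {s : ℂ} (hs : s ≠ 1) :
    zetaMulSubOne s / (s - 1) = riemannZeta s := by
  rw [zetaMulSubOne, LFunctionTrivChar₁, Function.update_of_ne hs,
    mul_div_cancel_left₀ _ (sub_ne_zero.2 hs), LFunctionTrivChar, LFunction_modOne_eq]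

theorem _root_.exists_norm_zetaMulSubOne_le : ∃ A : ℝ, 1 ≤ A ∧
    ∀ z ∈ Metric.sphere (2 : ℂ) (3 / 2), ‖zetaMulSubOne z‖ ≤ A := by
  obtain ⟨A, hA⟩ := (isCompact_sphere (2 : ℂ) (3 / 2)).exists_bound_of_continuousOn
    differentiable_zetaMulSubOne.continuous.continuousOn
  exact ⟨max 1 A, le_max_left _ _, fun z hz => (hA z hz).trans (le_max_right _ _)⟩

theorem _root_.re_and_norm_of_mem_sphere {z : ℂ} (hz : z ∈ Metric.sphere (2 : ℂ) (3 / 2)) :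
    1 / 2 ≤ z.re ∧ ‖z‖ ≤ 4 := by
  have h : ‖z - 2‖ = 3 / 2 := by simpa [dist_eq_norm] using hz
  constructor
  · have := (abs_le.1 ((Complex.abs_re_le_norm (z - 2)).trans h.le)).1
    simp at this
    linarith
  · have := norm_add_le (z - 2) 2
    rw [sub_add_cancel, h] at this
    norm_num at this
    linarith

theorem LSeries_coeff_mul_coeff (χ : DirichletCharacter ℂ N) {s : ℂ} (hs : 1 < s.re) :
    LSeries ⇑((1 : DirichletCharacter ℂ 1).coeff * χ.coeff) s =
      riemannZeta s * χ.LFunction s := by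
  rw [ArithmeticFunction.LSeries_mul' (LSeriesSummable_coeff _ hs) (LSeriesSummable_coeff _ hs),
    LSeries_coeff_one_modOne hs, LSeries_coeff, LFunction_eq_LSeries _ hs]

theorem LSeriesSummable_coeff_mul_coeff {M : ℕ} (χ : DirichletCharacter ℂ M) {s : ℂ}
    (hs : 1 < s.re) :
    LSeriesSummable ⇑((1 : DirichletCharacter ℂ 1).coeff * χ.coeff) s :=
  ArithmeticFunction.LSeriesSummable_mul (LSeriesSummable_coeff _ hs) (LSeriesSummable_coeff _ hs)

theorem _root_.exists_le_re_LFunction_one : ∃ A : ℝ, 1 ≤ A ∧ ∀ (N : ℕ) [NeZero N]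
    (χ : DirichletCharacter ℂ N), χ ≠ 1 → χ.IsQuadratic → ∀ β : ℝ, 3 / 4 ≤ β → β < 1 →
      (zetaMulSubOne β * χ.LFunction β / (β - 1)).re ≤ 0 →
      (1 - β) / 2 ≤ (χ.LFunction 1).re * (Real.exp 1 * (A * N) ^ (6 * (1 - β))) := by
  obtain ⟨A₁, hA₁, h₁⟩ := exists_norm_zetaMulSubOne_le
  obtain ⟨A₂, hA₂, h₂⟩ := exists_norm_LFunction_le_level
  have hA : 1 ≤ A₁ * A₂ := one_le_mul_of_one_le_of_one_le hA₁ hA₂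
  refine ⟨48 * (A₁ * A₂), by linarith, fun N _ χ hχ hq β hβ hβ1 hneg => ?_⟩
  have hN : (1 : ℝ) ≤ N := by exact_mod_cast NeZero.pos N
  have key := estermann_lower_bound (K := fun s => zetaMulSubOne s * χ.LFunction s)
    (a := ⇑((1 : DirichletCharacter ℂ 1).coeff * χ.coeff)) (B := A₁ * A₂ * N) (β := β)
    (coeff_mul_coeff_nonneg hq) (by simp [coeff_one])
    (abscissaOfAbsConv_le_one_of_forall_LSeriesSummable
      fun s => LSeriesSummable_coeff_mul_coeff χ)
    (differentiable_zetaMulSubOne.mul (differentiable_LFunction hχ))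
    (fun s hs => by
      rw [LSeries_coeff_mul_coeff χ hs, ← zetaMulSubOne_div (by rintro rfl; simp at hs)]
      ring)
    (one_le_mul_of_one_le_of_one_le hA hN)
    (fun z hz => by
      rw [norm_mul, mul_assoc]
      have hz' := re_and_norm_of_mem_sphere hz
      gcongr
      · exact h₁ z hz
      · exact h₂ N χ hχ z hz'.1 hz'.2)
    (by
      rw [norm_mul, mul_assoc, zetaMulSubOne_one]
      gcongr
      · simpa using hA₁
      · exact h₂ N χ hχ 1 (by norm_num) (by norm_num))
    hβ hβ1 hneg
  simpa only [zetaMulSubOne_one, one_mul, mul_assoc] using key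

theorem _root_.exists_le_re_mul_LFunction_one : ∃ A : ℝ, 1 ≤ A ∧ ∀ (N₁ N₂ : ℕ) [NeZero N₁]
    [NeZero N₂] (χ₁ : DirichletCharacter ℂ N₁) (χ₂ : DirichletCharacter ℂ N₂), χ₁ ≠ 1 → χ₂ ≠ 1 →
      prodChar χ₁ χ₂ ≠ 1 → χ₁.IsQuadratic → χ₂.IsQuadratic →
      ∀ β : ℝ, 3 / 4 ≤ β → β < 1 → χ₁.LFunction β = 0 →
      (1 - β) / 2 ≤ (χ₁.LFunction 1 * (χ₂.LFunction 1 * (prodChar χ₁ χ₂).LFunction 1)).re *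
        (Real.exp 1 * (A * (N₁ * (N₂ * (N₁ * N₂)))) ^ (6 * (1 - β))) := by
  obtain ⟨A₁, hA₁, h₁⟩ := exists_norm_zetaMulSubOne_le
  obtain ⟨A₂, hA₂, h₂⟩ := exists_norm_LFunction_le_level
  have hA : 1 ≤ A₁ * A₂ ^ 3 := one_le_mul_of_one_le_of_one_le hA₁ (one_le_pow₀ hA₂)
  refine ⟨48 * (A₁ * A₂ ^ 3), by linarith,
    fun N₁ N₂ _ _ χ₁ χ₂ hχ₁ hχ₂ hχ hq₁ hq₂ β hβ hβ1 hzero => ?_⟩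
  have hN₁ : (1 : ℝ) ≤ N₁ := by exact_mod_cast NeZero.pos N₁
  have hN₂ : (1 : ℝ) ≤ N₂ := by exact_mod_cast NeZero.pos N₂
  have hN : (1 : ℝ) ≤ N₁ * (N₂ * (N₁ * N₂)) :=
    one_le_mul_of_one_le_of_one_le hN₁ (one_le_mul_of_one_le_of_one_le hN₂
      (one_le_mul_of_one_le_of_one_le hN₁ hN₂))
  have hL : ∀ z : ℂ, 1 / 2 ≤ z.re → ‖z‖ ≤ 4 →
      ‖χ₁.LFunction z * (χ₂.LFunction z * (prodChar χ₁ χ₂).LFunction z)‖ ≤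
        A₂ ^ 3 * (N₁ * (N₂ * (N₁ * N₂))) := by
    intro z hz hz'
    have e : A₂ ^ 3 * (N₁ * (N₂ * (N₁ * N₂))) =
        (A₂ * N₁) * ((A₂ * N₂) * (A₂ * ((N₁ * N₂ : ℕ) : ℝ))) := by
      push_cast
      ring
    rw [norm_mul, norm_mul, e]
    gcongr
    · exact h₂ _ _ hχ₁ z hz hz'
    · exact h₂ _ _ hχ₂ z hz hz'
    · exact h₂ _ _ hχ z hz hz'
  have key := estermann_lower_bound
    (a := ⇑((1 : DirichletCharacter ℂ 1).coeff * χ₁.coeff *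
      (χ₂.coeff * (prodChar χ₁ χ₂).coeff)))
    (K := fun s => zetaMulSubOne s *
      (χ₁.LFunction s * (χ₂.LFunction s * (prodChar χ₁ χ₂).LFunction s)))
    (B := A₁ * (A₂ ^ 3 * (N₁ * (N₂ * (N₁ * N₂))))) (β := β)
    (coeff_mul_coeff_mul_nonneg hq₁ hq₂) (by simp [coeff_one])
    (abscissaOfAbsConv_le_one_of_forall_LSeriesSummable
      fun s hs => ArithmeticFunction.LSeriesSummable_mul (LSeriesSummable_coeff_mul_coeff χ₁ hs)
        (ArithmeticFunction.LSeriesSummable_mul (LSeriesSummable_coeff _ hs)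
          (LSeriesSummable_coeff _ hs)))
    (differentiable_zetaMulSubOne.mul ((differentiable_LFunction hχ₁).mul
      ((differentiable_LFunction hχ₂).mul (differentiable_LFunction hχ))))
    (fun s hs => by
      rw [ArithmeticFunction.LSeries_mul' (LSeriesSummable_coeff_mul_coeff χ₁ hs)
        (ArithmeticFunction.LSeriesSummable_mul (LSeriesSummable_coeff _ hs)
          (LSeriesSummable_coeff _ hs)), LSeries_coeff_mul_coeff χ₁ hs,
        ArithmeticFunction.LSeries_mul' (LSeriesSummable_coeff _ hs) (LSeriesSummable_coeff _ hs),
        LSeries_coeff, LSeries_coeff, LFunction_eq_LSeries _ hs, LFunction_eq_LSeries _ hs,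
        LFunction_eq_LSeries _ hs, ← zetaMulSubOne_div (by rintro rfl; simp at hs)]
      ring)
    (by rw [← mul_assoc]; exact one_le_mul_of_one_le_of_one_le hA hN)
    (fun z hz => by
      rw [norm_mul]
      have hz' := re_and_norm_of_mem_sphere hz
      exact mul_le_mul (h₁ z hz) (hL z hz'.1 hz'.2) (norm_nonneg _) (by linarith))
    (by
      rw [norm_mul, zetaMulSubOne_one, norm_one]
      exact mul_le_mul hA₁ (hL 1 (by norm_num) (by norm_num)) (norm_nonneg _) (by linarith))
    hβ hβ1 (by simp [hzero])
  simpa only [zetaMulSubOne_one, one_mul, mul_assoc] using key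

theorem LFunction_ofReal_im (hχ : χ ≠ 1) (hq : χ.IsQuadratic) {x : ℝ} (hx : 0 < x) :
    (χ.LFunction x).im = 0 := by
  have hcl : IsClosed {z : ℂ | z.im = 0} := isClosed_eq Complex.continuous_im continuous_const
  refine hcl.mem_of_tendsto (tendsto_sum_range_LFunction hχ (s := x) (by simpa using hx))
    (Filter.Eventually.of_forall fun M => ?_)
  change (∑ n ∈ Finset.range M, _ : ℂ).im = 0
  rw [Complex.im_sum]
  refine Finset.sum_eq_zero fun n _ => ?_
  have e : ((n : ℂ) + 1) ^ (-(x : ℂ)) = (((n + 1 : ℝ) ^ (-x) : ℝ) : ℂ) := by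
    rw [Complex.ofReal_cpow (by positivity)]
    push_cast
    rfl
  rw [e]
  rcases hq ((n + 1 : ℕ) : ZMod N) with h | h | h <;> rw [h] <;> simp

open scoped ComplexOrder in
theorem LFunction_ofReal_re_pos (hχ : χ ≠ 1) (hq : χ.IsQuadratic) {x : ℝ} (hx : 0 < x)
    (hx2 : x ≤ 2) (hzero : ∀ y : ℝ, x ≤ y → y < 1 → χ.LFunction y ≠ 0) :
    0 < (χ.LFunction x).re := by
  have h2 : 0 < (χ.LFunction (2 : ℝ)).re := by
    have hlt : LSeries.abscissaOfAbsConv ⇑((1 : DirichletCharacter ℂ 1).coeff * χ.coeff) <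
        ((2 : ℝ) : EReal) :=
      (abscissaOfAbsConv_le_one_of_forall_LSeriesSummable
        fun s => LSeriesSummable_coeff_mul_coeff χ).trans_lt (by exact_mod_cast one_lt_two)
    have h := LSeries.positive (coeff_mul_coeff_nonneg hq) (by simp [coeff_one]) hlt
    rw [LSeries_coeff_mul_coeff χ (by simp)] at h
    have hz : riemannZeta (2 : ℝ) = ((Real.pi ^ 2 / 6 : ℝ) : ℂ) := by
      push_cast
      exact riemannZeta_two
    rw [hz] at h
    have h' := (Complex.lt_def.1 h).1
    rw [Complex.re_ofReal_mul, Complex.zero_re] at h'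
    exact pos_of_mul_pos_right h' (by positivity)
  by_contra! hneg
  have hcont : ContinuousOn (fun y : ℝ => (χ.LFunction y).re) (Set.Icc x 2) :=
    (Complex.continuous_re.comp ((differentiable_LFunction hχ).continuous.comp
      Complex.continuous_ofReal)).continuousOn
  obtain ⟨y, hy, hy0⟩ := intermediate_value_Icc hx2 hcont ⟨hneg, h2.le⟩
  have hyz : χ.LFunction y = 0 :=
    Complex.ext hy0 (LFunction_ofReal_im hχ hq (hx.trans_le hy.1))
  rcases lt_or_ge y 1 with h | h
  · exact hzero y hy.1 h hyz
  · exact LFunction_ne_zero_of_one_le_re χ (.inl hχ) (by simpa using h) hyz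

theorem LFunction_one_re_pos (hχ : χ ≠ 1) (hq : χ.IsQuadratic) : 0 < (χ.LFunction 1).re := by
  simpa using LFunction_ofReal_re_pos hχ hq (x := 1) (by norm_num) (by norm_num)
    fun y hy hy1 => absurd hy hy1.not_ge

theorem norm_LFunction_one (hχ : χ ≠ 1) (hq : χ.IsQuadratic) :
    ‖χ.LFunction 1‖ = (χ.LFunction 1).re := by
  have h := LFunction_ofReal_im hχ hq (x := 1) (by norm_num)
  have e : χ.LFunction 1 = ((χ.LFunction 1).re : ℂ) :=
    Complex.ext (by simp) (by simpa using h)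
  rw [e, Complex.norm_real, Complex.ofReal_re, Real.norm_eq_abs,
    abs_of_pos (LFunction_one_re_pos hχ hq)]

end DirichletCharacter

section Siegel

open DirichletCharacter

theorem exists_zetaMulSubOne_re_pos : ∃ δ : ℝ, 0 < δ ∧ ∀ β : ℝ, 1 - δ ≤ β → β ≤ 1 →
    0 < (zetaMulSubOne β).re := by
  have hc : Continuous fun x : ℝ => (zetaMulSubOne x).re :=
    Complex.continuous_re.comp (differentiable_zetaMulSubOne.continuous.comp
      Complex.continuous_ofReal)
  have h1 : (fun x : ℝ => (zetaMulSubOne x).re) 1 = 1 := by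
    simp only [Complex.ofReal_one, zetaMulSubOne_one, Complex.one_re]
  have : {x : ℝ | 0 < (zetaMulSubOne x).re} ∈ nhds (1 : ℝ) :=
    (isOpen_lt continuous_const hc).mem_nhds (by
      change 0 < (fun x : ℝ => (zetaMulSubOne x).re) 1
      rw [h1]; norm_num)
  obtain ⟨δ, hδ, h⟩ := Metric.mem_nhds_iff.1 this
  refine ⟨δ / 2, by linarith, fun β hβ hβ1 => h ?_⟩
  rw [Metric.mem_ball, Real.dist_eq, abs_lt]
  constructor <;> linarith

/-- **Siegel's theorem** for a family of quadratic characters with pairwise nontrivial products. -/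
theorem siegel {ι : Type*} (q : ι → ℕ) [∀ i, NeZero (q i)] (χ : ∀ i, DirichletCharacter ℂ (q i))
    (hq : ∀ i, (χ i).IsQuadratic) (h1 : ∀ i, χ i ≠ 1)
    (h2 : ∀ i j, i ≠ j → prodChar (χ i) (χ j) ≠ 1) {η : ℝ} (hη : 0 < η) (hη1 : η < 1) :
    ∃ C : ℝ, 0 < C ∧ ∀ i, C * (q i : ℝ) ^ (-η) ≤ ((χ i).LFunction 1).re := by
  obtain ⟨δ₀, hδ₀, hζ⟩ := exists_zetaMulSubOne_re_pos
  obtain ⟨δ, hδ, hδ₀', hδ4, hδη⟩ : ∃ δ : ℝ, 0 < δ ∧ δ ≤ δ₀ ∧ δ ≤ 1 / 4 ∧ 24 * δ ≤ η :=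
    ⟨min δ₀ (min (1 / 4) (η / 24)), by positivity, min_le_left _ _,
      (min_le_right _ _).trans (min_le_left _ _), by
        have := (min_le_right δ₀ _).trans (min_le_right (1 / 4 : ℝ) (η / 24))
        linarith⟩
  have hqpos : ∀ i, (1 : ℝ) ≤ q i := fun i => by exact_mod_cast NeZero.pos (q i)
  by_cases hzero : ∃ i, ∃ β : ℝ, 1 - δ ≤ β ∧ β < 1 ∧ (χ i).LFunction β = 0
  · obtain ⟨i₀, β, hβ, hβ1, hz⟩ := hzero
    obtain ⟨A, hA, hlow⟩ := exists_le_re_mul_LFunction_one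
    obtain ⟨A', hA', hup⟩ := exists_norm_LFunction_one_le_rpow (η := η / 2) (by linarith)
      (by linarith)
    have hL₀ := LFunction_one_re_pos (h1 i₀) (hq i₀)
    have hq₀ := hqpos i₀
    set D : ℝ := ((χ i₀).LFunction 1).re * (A' * (q i₀ : ℝ) ^ (η / 2)) *
      (Real.exp 1 * (A * (q i₀ : ℝ) ^ 2) ^ (6 * (1 - β))) with hD
    have hDpos : 0 < D := by positivity
    refine ⟨min ((1 - β) / 2 / D) ((χ i₀).LFunction 1).re,
      lt_min (div_pos (by linarith) hDpos) hL₀, fun i => ?_⟩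
    have hqi := hqpos i
    have hqi0 : (0 : ℝ) < q i := by linarith
    rcases eq_or_ne i i₀ with rfl | hi
    · refine (mul_le_mul (min_le_right _ _) (Real.rpow_le_one_of_one_le_of_nonpos hqi
        (by linarith)) (by positivity) hL₀.le).trans (by simp)
    have hL := LFunction_one_re_pos (h1 i) (hq i)
    have key := hlow (q i₀) (q i) (χ i₀) (χ i) (h1 i₀) (h1 i) (h2 i₀ i hi.symm) (hq i₀) (hq i) β
      (by linarith) hβ1 hz
    have hre : ((χ i₀).LFunction 1 * ((χ i).LFunction 1 *
        (prodChar (χ i₀) (χ i)).LFunction 1)).re ≤ ((χ i₀).LFunction 1).re *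
          (((χ i).LFunction 1).re * (A' * ((q i₀ : ℝ) ^ (η / 2) * (q i : ℝ) ^ (η / 2)))) := by
      refine (Complex.re_le_norm _).trans ?_
      rw [norm_mul, norm_mul, norm_LFunction_one (h1 i₀) (hq i₀),
        norm_LFunction_one (h1 i) (hq i)]
      gcongr
      refine (hup _ _ (h2 i₀ i hi.symm)).trans (le_of_eq ?_)
      push_cast
      rw [Real.mul_rpow (by positivity) (by positivity)]
    have hpow : (A * (q i₀ * (q i * (q i₀ * q i)) : ℝ)) ^ (6 * (1 - β)) ≤
        (A * (q i₀ : ℝ) ^ 2) ^ (6 * (1 - β)) * (q i : ℝ) ^ (η / 2) := by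
      have e : A * (q i₀ * (q i * (q i₀ * q i)) : ℝ) =
          A * (q i₀ : ℝ) ^ 2 * (q i : ℝ) ^ (2 : ℝ) := by
        rw [Real.rpow_two]; ring
      rw [e, Real.mul_rpow (by positivity) (by positivity), ← Real.rpow_mul hqi0.le]
      gcongr
      linarith
    have hfin : (1 - β) / 2 ≤ ((χ i).LFunction 1).re * D * (q i : ℝ) ^ η := by
      refine (key.trans (mul_le_mul hre (mul_le_mul_of_nonneg_left hpow (Real.exp_pos 1).le)
        (by positivity) (by positivity))).trans (le_of_eq ?_)
      rw [show η = η / 2 + η / 2 by ring, Real.rpow_add hqi0, hD]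
      ring_nf
    calc _ ≤ (1 - β) / 2 / D * (q i : ℝ) ^ (-η) := by gcongr; exact min_le_left _ _
      _ ≤ (((χ i).LFunction 1).re * D * (q i : ℝ) ^ η) / D * (q i : ℝ) ^ (-η) := by gcongr
      _ = ((χ i).LFunction 1).re * ((q i : ℝ) ^ η * (q i : ℝ) ^ (-η)) := by field_simp
      _ = _ := by rw [← Real.rpow_add hqi0]; simp
  · push Not at hzero
    obtain ⟨A, hA, hlow⟩ := exists_le_re_LFunction_one
    set D : ℝ := Real.exp 1 * A ^ (6 * δ) with hD
    have hDpos : 0 < D := by positivity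
    refine ⟨δ / 2 / D, by positivity, fun i => ?_⟩
    have hqi := hqpos i
    have hqi0 : (0 : ℝ) < q i := by linarith
    have hL := LFunction_one_re_pos (h1 i) (hq i)
    have hneg : (zetaMulSubOne ((1 - δ : ℝ) : ℂ) * (χ i).LFunction ((1 - δ : ℝ) : ℂ) /
        (((1 - δ : ℝ) : ℂ) - 1)).re ≤ 0 := by
      have hpos := LFunction_ofReal_re_pos (h1 i) (hq i) (x := 1 - δ) (by linarith) (by linarith)
        fun y hy hy1 => hzero i y hy hy1
      have him := LFunction_ofReal_im (h1 i) (hq i) (x := 1 - δ) (by linarith)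
      have e : (χ i).LFunction ((1 - δ : ℝ) : ℂ) =
          (((χ i).LFunction ((1 - δ : ℝ) : ℂ)).re : ℂ) := Complex.ext (by simp) (by simpa using him)
      have e2 : (((1 - δ : ℝ) : ℂ) - 1) = ((-δ : ℝ) : ℂ) := by push_cast; ring
      rw [e, e2, Complex.div_ofReal_re, Complex.re_mul_ofReal]
      exact div_nonpos_of_nonneg_of_nonpos
        (mul_nonneg (hζ _ (by linarith) (by linarith)).le hpos.le) (by linarith)
    have key := hlow (q i) (χ i) (h1 i) (hq i) (1 - δ) (by linarith) (by linarith) hneg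
    rw [sub_sub_cancel, Real.mul_rpow (by positivity) (by positivity)] at key
    have hfin : δ / 2 ≤ ((χ i).LFunction 1).re * D * (q i : ℝ) ^ η := by
      refine key.trans ?_
      rw [hD, mul_assoc, mul_assoc]
      gcongr
      linarith
    calc _ ≤ (((χ i).LFunction 1).re * D * (q i : ℝ) ^ η) / D * (q i : ℝ) ^ (-η) := by gcongr
      _ = ((χ i).LFunction 1).re * ((q i : ℝ) ^ η * (q i : ℝ) ^ (-η)) := by field_simp
      _ = _ := by rw [← Real.rpow_add hqi0]; simp

end Siegel

section GaussSumSign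

open Polynomial Finset

theorem Polynomial.iterate_X_mul_derivative_X_sub_one_pow {R : Type*} [CommRing R] (m : ℕ)
    (V : R[X]) : ((fun f : R[X] => X * derivative f)^[m] ((X - 1) ^ m * V)).eval 1 =
      (m.factorial : R) * V.eval 1 := by
  induction m generalizing V with
  | zero => simp
  | succ m ih =>
    have e : X * derivative ((X - 1) ^ (m + 1) * V) =
        (X - 1) ^ m * (X * ((m + 1 : R[X]) * V + (X - 1) * derivative V)) := by
      simp only [derivative_mul, derivative_pow, derivative_sub, derivative_X, derivative_one,
        Nat.add_sub_cancel, C_eq_natCast]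
      push_cast
      ring
    rw [Function.iterate_succ_apply, e, ih, Nat.factorial_succ]
    simp
    ring

theorem Polynomial.iterate_X_mul_derivative_sum {R ι : Type*} [CommRing R] (s : Finset ι)
    (c : ι → R) (d : ι → ℕ) (m : ℕ) :
    ((fun f : R[X] => X * derivative f)^[m] (∑ i ∈ s, C (c i) * X ^ d i)) =
      ∑ i ∈ s, C (c i * (d i : R) ^ m) * X ^ d i := by
  induction m generalizing c with
  | zero => simp
  | succ m ih =>
    have e : X * derivative (∑ i ∈ s, C (c i) * X ^ d i) =
        ∑ i ∈ s, C (c i * (d i : R)) * X ^ d i := by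
      rw [derivative_sum, mul_sum]
      refine sum_congr rfl fun i _ => ?_
      rcases h : d i with _ | k
      · simp
      · simp [C_mul]
        ring
    rw [Function.iterate_succ_apply, e, ih]
    refine sum_congr rfl fun i _ => ?_
    rw [pow_succ', mul_assoc]

theorem Polynomial.iterate_X_mul_derivative_sub {R : Type*} [CommRing R] (f g : R[X]) (m : ℕ) :
    ((fun f : R[X] => X * derivative f)^[m] (f - g)) =
      ((fun f : R[X] => X * derivative f)^[m] f) - ((fun f : R[X] => X * derivative f)^[m] g) := by
  induction m generalizing f g with
  | zero => simp
  | succ m ih =>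
    have e : X * derivative (f - g) = X * derivative f - X * derivative g := by
      rw [derivative_sub, mul_sub]
    rw [Function.iterate_succ_apply, e, ih, Function.iterate_succ_apply,
      Function.iterate_succ_apply]

theorem Polynomial.X_sub_one_pow_dvd_map_of_aeval_eq_zero {p : ℕ} [Fact p.Prime] {ζ : ℂ}
    (hζ : IsPrimitiveRoot ζ p) {f : ℤ[X]} (hf : aeval ζ f = 0) :
    ((X : (ZMod p)[X]) - 1) ^ (p - 1) ∣ f.map (Int.castRingHom (ZMod p)) := by
  have hp := (Fact.out : p.Prime)
  have h1 : cyclotomic p ℤ ∣ f := by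
    rw [cyclotomic_eq_minpoly hζ hp.pos]
    exact minpoly.isIntegrallyClosed_dvd (hζ.isIntegral hp.pos) hf
  have h2 : ((X : (ZMod p)[X]) - 1) ^ (p - 1) = cyclotomic p (ZMod p) := by
    have h := cyclotomic_prime_mul_X_sub_one (ZMod p) p
    have h3 : (X ^ p - 1 : (ZMod p)[X]) = (X - 1) ^ (p - 1) * (X - 1) := by
      rw [← pow_succ, Nat.sub_add_cancel hp.one_le, sub_pow_char, one_pow]
    rw [h3] at h
    have hX : (X - 1 : (ZMod p)[X]) ≠ 0 := by simpa using X_sub_C_ne_zero (1 : ZMod p)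
    exact (mul_right_cancel₀ hX h).symm
  rw [h2, ← map_cyclotomic p (Int.castRingHom (ZMod p))]
  exact Polynomial.map_dvd _ h1

theorem ZMod.factorial_half_sq {p m : ℕ} [Fact p.Prime] (hm : p = 4 * m + 1) :
    (((2 * m).factorial : ZMod p)) ^ 2 = -1 := by
  have h := ZMod.wilsons_lemma p
  have e : p - 1 = 2 * m + 2 * m := by omega
  have h2 : ∏ i ∈ range (2 * m), ((2 * m + i + 1 : ℕ) : ZMod p) = ((2 * m).factorial : ZMod p) := by
    rw [← prod_range_reflect, ← prod_range_add_one_eq_factorial]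
    have : ∀ i ∈ range (2 * m), ((2 * m + (2 * m - 1 - i) + 1 : ℕ) : ZMod p) =
        -((i + 1 : ℕ) : ZMod p) := by
      intro i hi
      rw [eq_neg_iff_add_eq_zero, ← Nat.cast_add,
        show 2 * m + (2 * m - 1 - i) + 1 + (i + 1) = p by rw [mem_range] at hi; omega]
      simp
    rw [prod_congr rfl this, prod_neg, card_range, Nat.cast_prod]
    simp
  rw [e, ← Nat.factorial_mul_ascFactorial, Nat.ascFactorial_eq_prod_range, Nat.cast_mul,
    Nat.cast_prod] at h
  rw [sq, ← h]
  congr 1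
  rw [← h2]
  refine prod_congr rfl fun i _ => ?_
  congr 1
  ring

theorem prod_I_mul_sin {m : ℕ} (c : ℕ → ℂ) :
    ∏ k ∈ range (2 * m), ((-1) ^ (k + 1) * Complex.I * c k) = ∏ k ∈ range (2 * m), c k := by
  induction m with
  | zero => simp
  | succ m ih =>
    rw [show 2 * (m + 1) = 2 * m + 1 + 1 by ring, prod_range_succ, prod_range_succ, ih,
      prod_range_succ c, prod_range_succ c]
    have : (-1 : ℂ) ^ (2 * m) = 1 := by simp
    rw [pow_succ, pow_succ, pow_succ, this]
    ring_nf
    rw [Complex.I_sq]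
    ring

/-- The product of the `ζ ^ (2 m k) * (ζ ^ k - 1)` for `1 ≤ k ≤ 2 m` where `ζ` is the standard
primitive `p`-th root of unity, `p = 4 m + 1`, is the positive square root of `p`. -/
theorem prod_exp_eq_sqrt {p m : ℕ} (hm : p = 4 * m + 1) (hm0 : 0 < m) :
    ∏ k ∈ range (2 * m), (Complex.exp (2 * Real.pi * Complex.I / p) ^ ((k + 1) * (2 * m)) *
      (Complex.exp (2 * Real.pi * Complex.I / p) ^ (k + 1) - 1)) = (Real.sqrt p : ℂ) := by
  set ζ := Complex.exp (2 * Real.pi * Complex.I / p) with hζdef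
  have hp0 : (p : ℂ) ≠ 0 := by
    rw [hm]
    exact_mod_cast (4 * m).succ_ne_zero
  have hpr : (0 : ℝ) < p := by rw [hm]; positivity
  have hζ : IsPrimitiveRoot ζ p := Complex.isPrimitiveRoot_exp p (by omega)
  have hnorm : ‖ζ‖ = 1 := hζ.norm'_eq_one (by omega)
  set c : ℕ → ℝ := fun k => 2 * Real.sin (Real.pi * (k + 1) / p) with hc
  have hcpos : ∀ k ∈ range (2 * m), 0 < c k := by
    intro k hk
    rw [mem_range] at hk
    refine mul_pos two_pos (Real.sin_pos_of_pos_of_lt_pi (by positivity) ?_)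
    rw [div_lt_iff₀ hpr]
    refine mul_lt_mul_of_pos_left ?_ Real.pi_pos
    exact_mod_cast (by omega : k + 1 < p)
  have hfac : ∀ k : ℕ, ζ ^ ((k + 1) * (2 * m)) * (ζ ^ (k + 1) - 1) =
      (-1) ^ (k + 1) * Complex.I * (c k : ℂ) := by
    intro k
    set x : ℂ := Real.pi * (k + 1) / p * Complex.I with hx
    have h1 : ζ ^ ((k + 1) * (2 * m)) * Complex.exp x = (-1) ^ (k + 1) := by
      rw [hζdef, ← Complex.exp_nat_mul, ← Complex.exp_add, ← Complex.exp_pi_mul_I,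
        ← Complex.exp_nat_mul]
      congr 1
      rw [hx]
      field_simp
      rw [hm]
      push_cast
      ring
    have h2 : ζ ^ (k + 1) = Complex.exp x * Complex.exp x := by
      rw [hζdef, ← Complex.exp_nat_mul, ← Complex.exp_add]
      congr 1
      rw [hx]
      push_cast
      ring
    have h3 : (c k : ℂ) = (Complex.exp (-x) - Complex.exp x) * Complex.I := by
      rw [hc]
      push_cast
      rw [Complex.sin, hx, neg_mul]
      ring
    have h4 : Complex.exp x * Complex.exp (-x) = 1 := by rw [← Complex.exp_add]; simp
    rw [h3, ← h1, h2]
    linear_combination (ζ ^ ((k + 1) * (2 * m)) * (Complex.exp x * Complex.exp (-x) -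
      Complex.exp x * Complex.exp x)) * (-Complex.I_sq) - ζ ^ ((k + 1) * (2 * m)) * (-h4)
  have hP : ∏ k ∈ range (2 * m), (ζ ^ ((k + 1) * (2 * m)) * (ζ ^ (k + 1) - 1)) =
      ((∏ k ∈ range (2 * m), c k : ℝ) : ℂ) := by
    rw [prod_congr rfl fun k _ => hfac k, prod_I_mul_sin, Complex.ofReal_prod]
  have hpos : 0 < ∏ k ∈ range (2 * m), c k := prod_pos hcpos
  have hn : ∏ k ∈ range (2 * m), ‖1 - ζ ^ (k + 1)‖ = ∏ k ∈ range (2 * m), c k := by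
    have h := congrArg norm hP
    rw [Complex.norm_real, Real.norm_eq_abs, abs_of_pos hpos, norm_prod] at h
    rw [← h]
    refine prod_congr rfl fun k _ => ?_
    rw [norm_mul, norm_pow, hnorm, one_pow, one_mul, norm_sub_rev]
  have htot : ∏ k ∈ range (2 * m + 2 * m), ‖1 - ζ ^ (k + 1)‖ = p := by
    have h := IsPrimitiveRoot.prod_one_sub_pow_eq_order (n := 2 * m + 2 * m) (μ := ζ)
      (by convert hζ using 1; omega)
    rw [← norm_prod, h, hm]
    push_cast
    rw [show (2 * m + 2 * m + 1 : ℂ) = ((4 * m + 1 : ℝ) : ℂ) by push_cast; ring, Complex.norm_real,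
      Real.norm_of_nonneg (by positivity)]
  have hrefl : ∏ k ∈ range (2 * m), ‖1 - ζ ^ (2 * m + k + 1)‖ =
      ∏ k ∈ range (2 * m), ‖1 - ζ ^ (k + 1)‖ := by
    rw [← prod_range_reflect]
    refine prod_congr rfl fun k hk => ?_
    rw [mem_range] at hk
    have e : ζ ^ (2 * m + (2 * m - 1 - k) + 1) * ζ ^ (k + 1) = 1 := by
      rw [← pow_add, show 2 * m + (2 * m - 1 - k) + 1 + (k + 1) = p by omega, hζ.pow_eq_one]
    have e2 : ‖1 - ζ ^ (2 * m + (2 * m - 1 - k) + 1)‖ * ‖ζ ^ (k + 1)‖ = ‖1 - ζ ^ (k + 1)‖ := by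
      rw [← norm_mul, sub_mul, e, one_mul, norm_sub_rev]
    rw [← e2, norm_pow, hnorm, one_pow, mul_one]
  rw [prod_range_add, hrefl, hn] at htot
  rw [hP, ← htot, Real.sqrt_mul_self hpos.le]

/-- The quadratic character modulo `p` as a Dirichlet character. -/
noncomputable def quadraticDirichletChar (p : ℕ) [Fact p.Prime] : DirichletCharacter ℂ p :=
  (quadraticChar (ZMod p)).ringHomComp (Int.castRingHom ℂ)

theorem quadraticDirichletChar_apply {p : ℕ} [Fact p.Prime] (a : ZMod p) :
    quadraticDirichletChar p a = (quadraticChar (ZMod p) a : ℂ) := rfl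

theorem quadraticDirichletChar_isQuadratic (p : ℕ) [Fact p.Prime] :
    (quadraticDirichletChar p).IsQuadratic :=
  (quadraticChar_isQuadratic (ZMod p)).comp _

theorem quadraticDirichletChar_ne_one {p : ℕ} [Fact p.Prime] (hp : p ≠ 2) :
    quadraticDirichletChar p ≠ 1 := by
  have h : quadraticChar (ZMod p) ≠ 1 :=
    quadraticChar_ne_one (by rwa [ZMod.ringChar_zmod_n])
  exact (MulChar.ringHomComp_ne_one_iff (RingHom.injective_int _)).2 h

/-- The sign of the quadratic Gauss sum. -/
theorem gaussSum_quadraticDirichletChar {p : ℕ} [Fact p.Prime] (hp : p % 4 = 1) :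
    gaussSum (quadraticDirichletChar p) (ZMod.stdAddChar (N := p)) = (Real.sqrt p : ℂ) := by
  have hpp := (Fact.out : p.Prime)
  obtain ⟨m, hm⟩ : ∃ m, p = 4 * m + 1 := ⟨p / 4, by omega⟩
  have hm0 : 0 < m := by
    rcases Nat.eq_zero_or_pos m with rfl | h
    · exact absurd hm hpp.ne_one
    · exact h
  have hp2 : p ≠ 2 := by omega
  have hchar : ringChar (ZMod p) ≠ 2 := by rwa [ZMod.ringChar_zmod_n]
  set ζ := Complex.exp (2 * Real.pi * Complex.I / p) with hζdef
  have hζ : IsPrimitiveRoot ζ p := Complex.isPrimitiveRoot_exp p (by omega)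
  set f₁ : ℤ[X] := ∑ j : ZMod p, C (quadraticChar (ZMod p) j) * X ^ j.val with hf₁
  set f₂ : ℤ[X] := ∏ k ∈ range (2 * m), (X ^ ((k + 1) * (2 * m)) * (X ^ (k + 1) - 1)) with hf₂
  have hg : aeval ζ f₁ = gaussSum (quadraticDirichletChar p) (ZMod.stdAddChar (N := p)) := by
    rw [hf₁, gaussSum, map_sum]
    refine sum_congr rfl fun j _ => ?_
    have : ZMod.stdAddChar j = ζ ^ j.val := by
      have := ZMod.stdAddChar_coe (N := p) (j.val : ℤ)
      rw [Int.cast_natCast, ZMod.natCast_zmod_val] at this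
      rw [this, hζdef, ← Complex.exp_nat_mul]
      congr 1
      push_cast
      ring
    rw [this, quadraticDirichletChar_apply]
    simp
  have hP : aeval ζ f₂ = (Real.sqrt p : ℂ) := by
    rw [← prod_exp_eq_sqrt hm hm0, hf₂, map_prod]
    simp [hζdef]
  have hsq : gaussSum (quadraticDirichletChar p) (ZMod.stdAddChar (N := p)) ^ 2 =
      (Real.sqrt p : ℂ) ^ 2 := by
    rw [gaussSum_sq (χ := quadraticDirichletChar p) (quadraticDirichletChar_ne_one hp2)
      (quadraticDirichletChar_isQuadratic p) (ZMod.isPrimitive_stdAddChar p), ZMod.card,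
      quadraticDirichletChar_apply, quadraticChar_neg_one hchar, ZMod.card, ZMod.χ₄_nat_one_mod_four hp,
      ← Complex.ofReal_pow, Real.sq_sqrt (by positivity)]
    simp
  rcases sq_eq_sq_iff_eq_or_eq_neg.1 hsq with h | h
  · exact h
  exfalso
  have hzero : aeval ζ (f₁ - C (-1) * f₂) = 0 := by
    rw [map_sub, map_mul, hg, hP, h]
    simp
  obtain ⟨W, hW⟩ := X_sub_one_pow_dvd_map_of_aeval_eq_zero hζ hzero
  have e₁ : f₁.map (Int.castRingHom (ZMod p)) =
      ∑ j : ZMod p, C ((quadraticChar (ZMod p) j : ZMod p)) * X ^ j.val := by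
    simp [hf₁, Polynomial.map_sum]
  set V : (ZMod p)[X] := ∏ k ∈ range (2 * m),
    (X ^ ((k + 1) * (2 * m)) * ∑ i ∈ range (k + 1), X ^ i) with hV
  have e₂ : f₂.map (Int.castRingHom (ZMod p)) = (X - 1) ^ (2 * m) * V := by
    rw [hf₂, hV, Polynomial.map_prod]
    have hc : ((X : (ZMod p)[X]) - 1) ^ (2 * m) = ∏ _k ∈ range (2 * m), (X - 1) := by simp
    rw [hc, ← prod_mul_distrib]
    refine prod_congr rfl fun k _ => ?_
    simp only [Polynomial.map_mul, Polynomial.map_pow, map_X, Polynomial.map_sub,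
      Polynomial.map_one]
    rw [← geom_sum_mul]
    ring
  have hV1 : V.eval 1 = ((2 * m).factorial : ZMod p) := by
    rw [hV, eval_prod, ← prod_range_add_one_eq_factorial, Nat.cast_prod]
    refine prod_congr rfl fun k _ => ?_
    simp [eval_finsetSum]
  have hfin : (X - 1) ^ (2 * m) * ((X - 1) ^ (2 * m) * W) =
      (∑ j : ZMod p, C ((quadraticChar (ZMod p) j : ZMod p)) * X ^ j.val) -
        (X - 1) ^ (2 * m) * (-V) := by
    rw [← mul_assoc, ← pow_add, show 2 * m + 2 * m = p - 1 by omega, ← hW, Polynomial.map_sub,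
      e₁, Polynomial.map_mul, e₂]
    simp
  have key := congrArg (fun f => ((fun f : (ZMod p)[X] => X * derivative f)^[2 * m] f).eval 1) hfin
  simp only [iterate_X_mul_derivative_sub, eval_sub, iterate_X_mul_derivative_X_sub_one_pow,
    iterate_X_mul_derivative_sum, eval_finsetSum, eval_mul, eval_C, eval_pow, eval_X, one_pow,
    eval_one, sub_self, eval_neg, hV1] at key
  have hsum : ∑ j : ZMod p, (quadraticChar (ZMod p) j : ZMod p) * ((j.val : ℕ) : ZMod p) ^ (2 * m) =
      -1 := by
    have : ∀ j : ZMod p, (quadraticChar (ZMod p) j : ZMod p) * ((j.val : ℕ) : ZMod p) ^ (2 * m) =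
        if j = 0 then 0 else 1 := by
      intro j
      split_ifs with hj
      · simp [hj]
      · rw [ZMod.natCast_zmod_val, quadraticChar_eq_pow_of_char_ne_two' hchar, ZMod.card,
          show p / 2 = 2 * m by omega, ← pow_add, show 2 * m + 2 * m = p - 1 by omega,
          ZMod.pow_card_sub_one_eq_one hj]
    rw [sum_congr rfl fun j _ => this j]
    simp [sum_ite, filter_ne', card_erase_of_mem, Nat.cast_pred hpp.pos]
  have hfact := ZMod.factorial_half_sq hm
  simp only [mul_one, hsum] at key
  rw [zero_pow (by omega)] at key
  have h2 : (2 : ZMod p) = 0 := by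
    linear_combination key + hfact
  exact Ring.two_ne_zero hchar h2

end GaussSumSign

section ArctanUnitCircle

open Complex

theorem one_add_mul_I_div_one_sub_mul_I {z : ℂ} (hz : ‖z‖ = 1) (hre : z.re ≠ 0) :
    1 - z * I ≠ 0 ∧
      (1 + z * I) / (1 - z * I) = ((2 * z.re / normSq (1 - z * I) : ℝ) : ℂ) * I := by
  have hne : 1 - z * I ≠ 0 := by
    intro h
    have := congrArg Complex.im h
    simp at this
    exact hre this
  refine ⟨hne, ?_⟩
  have hconj : z * (starRingEnd ℂ) z = 1 := by
    rw [Complex.mul_conj, Complex.normSq_eq_norm_sq, hz]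
    simp
  have h2 : z + (starRingEnd ℂ) z = 2 * (z.re : ℂ) := by
    rw [Complex.add_conj]
    push_cast
    ring
  have hn0 : (starRingEnd ℂ) (1 - z * I) ≠ 0 := (map_ne_zero _).2 hne
  rw [Complex.ofReal_div, ← Complex.mul_conj, div_mul_eq_mul_div, div_eq_div_iff hne
    (mul_ne_zero hne hn0)]
  simp only [map_sub, map_one, map_mul, Complex.conj_I]
  push_cast
  linear_combination (1 - z * I) * I * h2 + (1 - z * I) * (I ^ 2 * 1) * hconj
    + (1 - z * I) * Complex.I_sq

theorem continuousAt_arctan_of_norm_eq_one {z : ℂ} (hz : ‖z‖ = 1) (hre : z.re ≠ 0) :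
    ContinuousAt Complex.arctan z := by
  obtain ⟨hne, hw⟩ := one_add_mul_I_div_one_sub_mul_I hz hre
  have hpos := Complex.normSq_pos.2 hne
  unfold Complex.arctan
  refine continuousAt_const.mul (ContinuousAt.clog (ContinuousAt.div (by fun_prop) (by fun_prop)
    hne) ?_)
  rw [hw, Complex.mem_slitPlane_iff]
  right
  rw [Complex.im_ofReal_mul, Complex.I_im, mul_one]
  positivity

theorem re_arctan_of_norm_eq_one {z : ℂ} (hz : ‖z‖ = 1) (hre : z.re ≠ 0) :
    (Complex.arctan z).re = if 0 < z.re then Real.pi / 4 else -(Real.pi / 4) := by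
  obtain ⟨hne, hw⟩ := one_add_mul_I_div_one_sub_mul_I hz hre
  have hpos := Complex.normSq_pos.2 hne
  have h : (Complex.arctan z).re = arg ((1 + z * I) / (1 - z * I)) / 2 := by
    unfold Complex.arctan
    rw [show ∀ w : ℂ, -I / 2 * w = ((-1 / 2 : ℝ) : ℂ) * (I * w) by intro w; push_cast; ring,
      Complex.re_ofReal_mul, Complex.I_mul_re, Complex.log_im]
    ring
  rw [h, hw]
  split_ifs with hp
  · rw [Complex.arg_real_mul _ (by positivity), Complex.arg_I]
    ring
  · have hlt : z.re < 0 := lt_of_le_of_ne (not_lt.1 hp) hre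
    rw [show ((2 * z.re / normSq (1 - z * I) : ℝ) : ℂ) * I =
      ((2 * (-z.re) / normSq (1 - z * I) : ℝ) : ℂ) * (-I) by push_cast; ring,
      Complex.arg_real_mul _ (div_pos (by linarith) hpos), Complex.arg_neg_I]
    ring

end ArctanUnitCircle

section CharacterSum

open DirichletCharacter Finset

/-- The nontrivial character modulo `4` as a complex Dirichlet character. -/
noncomputable def dirichletCharFour : DirichletCharacter ℂ 4 :=
  ZMod.χ₄.ringHomComp (Int.castRingHom ℂ)

theorem dirichletCharFour_apply (n : ℕ) :
    dirichletCharFour n = if n % 2 = 0 then 0 else if n % 4 = 1 then 1 else -1 := by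
  have : dirichletCharFour n = ((ZMod.χ₄ n : ℤ) : ℂ) := rfl
  rw [this, ZMod.χ₄_nat_eq_if_mod_four]
  split_ifs <;> simp

theorem dirichletCharFour_two_mul_add_one (n : ℕ) :
    dirichletCharFour ((2 * n + 1 : ℕ) : ZMod 4) = (-1) ^ n := by
  rw [dirichletCharFour_apply, if_neg (by omega)]
  rcases Nat.even_or_odd n with h | h
  · rw [h.neg_one_pow, if_pos]
    obtain ⟨k, rfl⟩ := h
    omega
  · rw [h.neg_one_pow, if_neg]
    obtain ⟨k, rfl⟩ := h
    omega

theorem dirichletCharFour_isQuadratic : dirichletCharFour.IsQuadratic :=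
  ZMod.isQuadratic_χ₄.comp _

theorem hasSum_dirichletCharFour_arctan {z : ℂ} (hz : ‖z‖ < 1) :
    HasSum (fun n : ℕ => dirichletCharFour ((n + 1 : ℕ) : ZMod 4) * z ^ (n + 1) / ((n : ℂ) + 1))
      (Complex.arctan z) := by
  have hinj : Function.Injective (fun n : ℕ => 2 * n) := fun a b h => by
    simpa using h
  refine (hinj.hasSum_iff ?_).1 ?_
  · intro n hn
    have : (n + 1) % 2 = 0 := by
      by_contra h
      exact hn ⟨n / 2, by dsimp only; omega⟩
    rw [dirichletCharFour_apply, if_pos this]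
    simp
  · refine (Complex.hasSum_arctan hz).congr_fun ?_
    intro n
    simp only [Function.comp_apply]
    rw [dirichletCharFour_two_mul_add_one]
    push_cast
    rfl

variable {p : ℕ} [Fact p.Prime]

theorem sum_quadraticDirichletChar_mul_stdAddChar_pow (hp : p % 4 = 1) (n : ℕ) :
    ∑ a : ZMod p, quadraticDirichletChar p a * ZMod.stdAddChar a ^ n =
      (Real.sqrt p : ℂ) * quadraticDirichletChar p n := by
  have hp2 : p ≠ 2 := by omega
  have e : ∀ a : ZMod p, (ZMod.stdAddChar a : ℂ) ^ n = ZMod.stdAddChar ((n : ZMod p) * a) := by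
    intro a
    rw [← AddChar.map_nsmul_eq_pow, nsmul_eq_mul]
  simp only [e]
  by_cases h : (n : ZMod p) = 0
  · simp only [h, zero_mul, AddChar.map_zero_eq_one, mul_one]
    rw [MulChar.sum_eq_zero_of_ne_one (quadraticDirichletChar_ne_one hp2), MulChar.map_zero,
      mul_zero]
  · obtain ⟨u, hu⟩ := isUnit_iff_ne_zero.2 h
    have h1 := gaussSum_mulShift_eq (quadraticDirichletChar p) (ZMod.stdAddChar (N := p)) u
    rw [gaussSum_quadraticDirichletChar hp, (quadraticDirichletChar_isQuadratic p).inv, hu] at h1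
    rw [mul_comm, ← h1]
    rfl

/-- The real quadratic character modulo `4 * p` attached to `ℚ(√-p)` for `p ≡ 1 mod 4`. -/
noncomputable def quadraticDirichletCharFourMul (p : ℕ) [Fact p.Prime] :
    DirichletCharacter ℂ (4 * p) :=
  prodChar dirichletCharFour (quadraticDirichletChar p)

theorem quadraticDirichletCharFourMul_apply (n : ℕ) :
    quadraticDirichletCharFourMul p n = dirichletCharFour n * quadraticDirichletChar p n :=
  prodChar_apply _ _ _

theorem hasSum_quadraticDirichletCharFourMul (hp : p % 4 = 1) {r : ℝ} (hr : 0 < r) (hr1 : r < 1) :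
    HasSum (fun n : ℕ => (Real.sqrt p : ℂ) *
        (quadraticDirichletCharFourMul p ((n + 1 : ℕ) : ZMod (4 * p)) * (r : ℂ) ^ (n + 1) /
          ((n : ℂ) + 1)))
      (∑ a : ZMod p, quadraticDirichletChar p a * Complex.arctan (r * ZMod.stdAddChar a)) := by
  have h := hasSum_sum (s := (univ : Finset (ZMod p))) fun a _ =>
    (hasSum_dirichletCharFour_arctan (z := r * ZMod.stdAddChar a) (by
      rw [norm_mul, AddChar.norm_apply, mul_one, Complex.norm_real, Real.norm_of_nonneg hr.le]
      exact hr1)).mul_left (quadraticDirichletChar p a)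
  refine h.congr_fun fun n => ?_
  have e := sum_quadraticDirichletChar_mul_stdAddChar_pow hp (n + 1)
  rw [quadraticDirichletCharFourMul_apply, mul_comm (dirichletCharFour _), mul_assoc, mul_div_assoc,
    ← mul_assoc, ← e, sum_mul]
  refine sum_congr rfl fun a _ => ?_
  rw [mul_pow]
  ring

theorem sqrt_mul_LFunction_one_eq_sum_arctan (hp : p % 4 = 1)
    (hψ : quadraticDirichletCharFourMul p ≠ 1)
    (hre : ∀ a : ZMod p, (ZMod.stdAddChar a : ℂ).re ≠ 0) :
    (Real.sqrt p : ℂ) * (quadraticDirichletCharFourMul p).LFunction 1 =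
      ∑ a : ZMod p, quadraticDirichletChar p a * Complex.arctan (ZMod.stdAddChar a) := by
  set ψ := quadraticDirichletCharFourMul p with hψdef
  have habel := Complex.tendsto_tsum_powerSeries_nhdsWithin_lt
    (tendsto_sum_range_LFunction hψ (s := 1) (by simp))
  have hof : Filter.Tendsto (fun r : ℝ => (r : ℂ)) (nhdsWithin 1 (Set.Iio 1)) (nhds 1) := by
    have := (Complex.continuous_ofReal.tendsto (1 : ℝ)).mono_left
      (nhdsWithin_le_nhds (s := Set.Iio 1))
    simpa using this
  have h1 := (hof.mul (Filter.tendsto_map'_iff.1 habel)).const_mul (Real.sqrt p : ℂ)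
  rw [one_mul] at h1
  have h2 : Filter.Tendsto (fun r : ℝ => ∑ a : ZMod p, quadraticDirichletChar p a *
      Complex.arctan (r * ZMod.stdAddChar a)) (nhdsWithin 1 (Set.Iio 1))
      (nhds (∑ a : ZMod p, quadraticDirichletChar p a * Complex.arctan (ZMod.stdAddChar a))) := by
    refine tendsto_finsetSum _ fun a _ => Filter.Tendsto.const_mul _ ?_
    have hc := continuousAt_arctan_of_norm_eq_one
      (AddChar.norm_apply (ZMod.stdAddChar (N := p)) a) (hre a)
    refine hc.tendsto.comp ?_
    simpa using hof.mul_const (ZMod.stdAddChar a : ℂ)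
  refine tendsto_nhds_unique (h1.congr' ?_) h2
  filter_upwards [Ioo_mem_nhdsLT (zero_lt_one' ℝ)] with r hr
  rw [← (hasSum_quadraticDirichletCharFourMul hp hr.1 hr.2).tsum_eq, tsum_mul_left]
  congr 1
  simp only [Function.comp_apply]
  rw [← tsum_mul_left]
  refine tsum_congr fun n => ?_
  rw [Complex.cpow_neg_one]
  ring

end CharacterSum

section QuarterSum

open DirichletCharacter Finset

theorem ZMod.stdAddChar_natCast_re {p : ℕ} [NeZero p] (j : ℕ) :
    (ZMod.stdAddChar ((j : ℕ) : ZMod p) : ℂ).re = Real.cos (2 * Real.pi * j / p) := by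
  have h := ZMod.stdAddChar_coe (N := p) (j : ℤ)
  rw [Int.cast_natCast] at h
  rw [h, show (2 * Real.pi * Complex.I * ((j : ℤ) : ℂ) / p : ℂ) =
    ((2 * Real.pi * j / p : ℝ) : ℂ) * Complex.I by push_cast; ring, Complex.exp_ofReal_mul_I_re]

theorem cos_two_pi_mul_div_pos {p m j : ℕ} (hm : p = 4 * m + 1) (hj : j ≤ m ∨ 3 * m < j)
    (hjp : j < p) : 0 < Real.cos (2 * Real.pi * j / p) := by
  have hp : (0 : ℝ) < p := by exact_mod_cast (by omega : 0 < p)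
  have hpi := Real.pi_pos
  have key : ∀ x : ℝ, x < p → -(p : ℝ) < x → 0 < Real.cos (Real.pi / 2 * (x / p)) := by
    intro x h1 h2
    have h1' : x / p < 1 := (div_lt_one hp).2 h1
    have h2' : -1 < x / p := by rw [lt_div_iff₀ hp]; linarith
    exact Real.cos_pos_of_mem_Ioo ⟨by nlinarith, by nlinarith⟩
  rcases hj with h | h
  · have h1 : (4 * j : ℝ) < p := by exact_mod_cast (by omega : 4 * j < p)
    convert key (4 * j) h1 (by linarith [(by positivity : (0 : ℝ) ≤ 4 * j)]) using 2
    ring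
  · have h1 : (3 * p : ℝ) < 4 * j := by exact_mod_cast (by omega : 3 * p < 4 * j)
    have h2 : (j : ℝ) < p := by exact_mod_cast hjp
    rw [← Real.cos_sub_two_pi]
    convert key (4 * j - 4 * p) (by linarith) (by linarith) using 2
    field_simp
    ring

theorem cos_two_pi_mul_div_neg {p m j : ℕ} (hm : p = 4 * m + 1) (hj : m < j) (hj' : j ≤ 3 * m) :
    Real.cos (2 * Real.pi * j / p) < 0 := by
  have hp : (0 : ℝ) < p := by exact_mod_cast (by omega : 0 < p)
  have hpi := Real.pi_pos
  have h1 : (p : ℝ) < 4 * j := by exact_mod_cast (by omega : p < 4 * j)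
  have h2 : (4 * j : ℝ) < 3 * p := by exact_mod_cast (by omega : 4 * j < 3 * p)
  refine Real.cos_neg_of_pi_div_two_lt_of_lt ?_ ?_
  · rw [lt_div_iff₀ hp]
    nlinarith
  · rw [div_lt_iff₀ hp]
    nlinarith

theorem ZMod.sum_eq_sum_range {p : ℕ} [NeZero p] {M : Type*} [AddCommMonoid M] (f : ZMod p → M) :
    ∑ a, f a = ∑ j ∈ range p, f j :=
  sum_nbij' ZMod.val (fun j => (j : ZMod p)) (fun a _ => mem_range.2 a.val_lt)
    (fun _ _ => mem_univ _) (fun a _ => ZMod.natCast_zmod_val a)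
    (fun j hj => ZMod.val_cast_of_lt (mem_range.1 hj)) (fun a _ => by rw [ZMod.natCast_zmod_val])

theorem sum_range_four_mul_add_one {M : Type*} [AddCommMonoid M] (f : ℕ → M) {n m : ℕ}
    (hn : n = 4 * m + 1) : ∑ j ∈ range n, f j = f 0 + (∑ i ∈ range m, f (i + 1) +
      ∑ i ∈ range (2 * m), f (m + i + 1) + ∑ i ∈ range m, f (3 * m + i + 1)) := by
  rw [hn, sum_range_succ', add_comm, show 4 * m = m + 2 * m + m by ring, sum_range_add,
    sum_range_add, show m + 2 * m = 3 * m by ring]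

variable {p : ℕ} [Fact p.Prime]

theorem sum_quadraticChar_last_quarter (hp : p % 4 = 1) {m : ℕ} (hm : p = 4 * m + 1) :
    ∑ i ∈ range m, quadraticChar (ZMod p) ((3 * m + i + 1 : ℕ) : ZMod p) =
      ∑ i ∈ range m, quadraticChar (ZMod p) ((i + 1 : ℕ) : ZMod p) := by
  have hchar : ringChar (ZMod p) ≠ 2 := by
    rw [ZMod.ringChar_zmod_n]
    omega
  rw [← sum_range_reflect]
  refine sum_congr rfl fun i hi => ?_
  rw [mem_range] at hi
  have : ((3 * m + (m - 1 - i) + 1 : ℕ) : ZMod p) = (-1) * ((i + 1 : ℕ) : ZMod p) := by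
    rw [neg_one_mul, eq_neg_iff_add_eq_zero, ← Nat.cast_add,
      show 3 * m + (m - 1 - i) + 1 + (i + 1) = p by omega, ZMod.natCast_self]
  rw [this, map_mul, quadraticChar_neg_one hchar, ZMod.card, ZMod.χ₄_nat_one_mod_four hp, one_mul]

theorem sum_quadraticChar_middle (hp : p % 4 = 1) {m : ℕ} (hm : p = 4 * m + 1) :
    ∑ i ∈ range (2 * m), quadraticChar (ZMod p) ((m + i + 1 : ℕ) : ZMod p) =
      -(2 * ∑ i ∈ range m, quadraticChar (ZMod p) ((i + 1 : ℕ) : ZMod p)) := by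
  have hchar : ringChar (ZMod p) ≠ 2 := by
    rw [ZMod.ringChar_zmod_n]
    omega
  have h := quadraticChar_sum_zero hchar
  have e := sum_range_four_mul_add_one
    (fun j : ℕ => quadraticChar (ZMod p) ((j : ℕ) : ZMod p)) hm
  rw [← ZMod.sum_eq_sum_range (fun a => quadraticChar (ZMod p) a), h,
    sum_quadraticChar_last_quarter hp hm] at e
  simp only [Nat.cast_zero, MulChar.map_zero, zero_add] at e
  linarith

theorem sqrt_mul_LFunction_one_re (hp : p % 4 = 1) {m : ℕ} (hm : p = 4 * m + 1)
    (hψ : quadraticDirichletCharFourMul p ≠ 1) :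
    Real.sqrt p * ((quadraticDirichletCharFourMul p).LFunction 1).re =
      Real.pi * (∑ i ∈ range m, quadraticChar (ZMod p) ((i + 1 : ℕ) : ZMod p) : ℤ) := by
  have hpp := (Fact.out : p.Prime)
  have hpos : ∀ j : ℕ, j ≤ m ∨ 3 * m < j → j < p →
      0 < (ZMod.stdAddChar ((j : ℕ) : ZMod p) : ℂ).re := fun j h h' => by
    rw [ZMod.stdAddChar_natCast_re]
    exact cos_two_pi_mul_div_pos hm h h'
  have hneg : ∀ j : ℕ, m < j → j ≤ 3 * m →
      (ZMod.stdAddChar ((j : ℕ) : ZMod p) : ℂ).re < 0 := fun j h h' => by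
    rw [ZMod.stdAddChar_natCast_re]
    exact cos_two_pi_mul_div_neg hm h h'
  have hre : ∀ a : ZMod p, (ZMod.stdAddChar a : ℂ).re ≠ 0 := by
    intro a
    rw [← ZMod.natCast_zmod_val a]
    by_cases h : a.val ≤ m ∨ 3 * m < a.val
    · exact (hpos _ h a.val_lt).ne'
    · exact (hneg _ (by omega) (by omega)).ne
  have harc : ∀ a : ZMod p, (quadraticDirichletChar p a * Complex.arctan (ZMod.stdAddChar a)).re =
      (quadraticChar (ZMod p) a : ℝ) * if 0 < (ZMod.stdAddChar a : ℂ).re then Real.pi / 4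
        else -(Real.pi / 4) := by
    intro a
    have e : quadraticDirichletChar p a = (((quadraticChar (ZMod p) a : ℤ) : ℝ) : ℂ) := by
      rw [quadraticDirichletChar_apply]
      push_cast
      rfl
    rw [e, Complex.re_ofReal_mul, re_arctan_of_norm_eq_one
      (AddChar.norm_apply (ZMod.stdAddChar (N := p)) a) (hre a)]
  have h := congrArg Complex.re (sqrt_mul_LFunction_one_eq_sum_arctan hp hψ hre)
  rw [Complex.re_ofReal_mul, Complex.re_sum, sum_congr rfl fun a _ => harc a,
    ZMod.sum_eq_sum_range, sum_range_four_mul_add_one _ hm] at h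
  rw [h]
  have s₁ : ∑ i ∈ range m, (quadraticChar (ZMod p) ((i + 1 : ℕ) : ZMod p) : ℝ) *
      (if 0 < (ZMod.stdAddChar ((i + 1 : ℕ) : ZMod p) : ℂ).re then Real.pi / 4
        else -(Real.pi / 4)) =
      (∑ i ∈ range m, quadraticChar (ZMod p) ((i + 1 : ℕ) : ZMod p) : ℤ) * (Real.pi / 4) := by
    push_cast
    rw [sum_mul]
    refine sum_congr rfl fun i hi => ?_
    rw [mem_range] at hi
    have := hpos (i + 1) (by omega) (by omega)
    push_cast at this
    rw [if_pos this]
  have s₂ : ∑ i ∈ range (2 * m), (quadraticChar (ZMod p) ((m + i + 1 : ℕ) : ZMod p) : ℝ) *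
      (if 0 < (ZMod.stdAddChar ((m + i + 1 : ℕ) : ZMod p) : ℂ).re then Real.pi / 4
        else -(Real.pi / 4)) =
      (∑ i ∈ range (2 * m), quadraticChar (ZMod p) ((m + i + 1 : ℕ) : ZMod p) : ℤ) *
        -(Real.pi / 4) := by
    push_cast
    rw [sum_mul]
    refine sum_congr rfl fun i hi => ?_
    rw [mem_range] at hi
    have := hneg (m + i + 1) (by omega) (by omega)
    push_cast at this
    rw [if_neg this.not_gt]
  have s₃ : ∑ i ∈ range m, (quadraticChar (ZMod p) ((3 * m + i + 1 : ℕ) : ZMod p) : ℝ) *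
      (if 0 < (ZMod.stdAddChar ((3 * m + i + 1 : ℕ) : ZMod p) : ℂ).re then Real.pi / 4
        else -(Real.pi / 4)) =
      (∑ i ∈ range m, quadraticChar (ZMod p) ((3 * m + i + 1 : ℕ) : ZMod p) : ℤ) *
        (Real.pi / 4) := by
    push_cast
    rw [sum_mul]
    refine sum_congr rfl fun i hi => ?_
    rw [mem_range] at hi
    have := hpos (3 * m + i + 1) (by omega) (by omega)
    push_cast at this
    rw [if_pos this]
  rw [s₁, s₂, s₃, sum_quadraticChar_middle hp hm, sum_quadraticChar_last_quarter hp hm]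
  simp only [Nat.cast_zero, MulChar.map_zero, Int.cast_zero, zero_mul, zero_add]
  push_cast
  ring

end QuarterSum

section QuadraticFamily

open DirichletCharacter

theorem DirichletCharacter.IsQuadratic.prodChar {N₁ N₂ : ℕ} [NeZero N₁] [NeZero N₂]
    {χ₁ : DirichletCharacter ℂ N₁} {χ₂ : DirichletCharacter ℂ N₂} (h₁ : χ₁.IsQuadratic)
    (h₂ : χ₂.IsQuadratic) : (prodChar χ₁ χ₂).IsQuadratic := by
  intro a
  rw [← ZMod.natCast_zmod_val a, prodChar_apply]
  rcases h₁ a.val with h | h | h <;> rcases h₂ a.val with h' | h' | h' <;> rw [h, h'] <;> simp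

theorem DirichletCharacter.ne_one_of_apply_eq_neg_one {N : ℕ} {χ : DirichletCharacter ℂ N}
    {a : ZMod N} (h : χ a = -1) : χ ≠ 1 := by
  rintro rfl
  by_cases ha : IsUnit a
  · rw [MulChar.one_apply ha] at h
    norm_num at h
  · rw [MulChar.map_nonunit _ ha] at h
    norm_num at h

variable {p q : ℕ} [Fact p.Prime] [Fact q.Prime]

theorem quadraticDirichletCharFourMul_isQuadratic :
    (quadraticDirichletCharFourMul p).IsQuadratic :=
  DirichletCharacter.IsQuadratic.prodChar dirichletCharFour_isQuadratic
    (quadraticDirichletChar_isQuadratic p)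

theorem coprime_four_of_mod_four_eq_one {n : ℕ} (hn : n % 4 = 1) : Nat.Coprime 4 n := by
  have : Nat.Coprime (2 ^ 2) n := Nat.Coprime.pow_left 2 (Nat.coprime_two_left.2 (by
    rw [Nat.odd_iff]
    omega))
  simpa using this

theorem quadraticDirichletCharFourMul_ne_one (hp : p % 4 = 1) :
    quadraticDirichletCharFourMul p ≠ 1 := by
  obtain ⟨n, h4, h1⟩ := Nat.chineseRemainder (coprime_four_of_mod_four_eq_one hp) 3 1
  refine ne_one_of_apply_eq_neg_one (a := n) ?_
  rw [quadraticDirichletCharFourMul_apply, dirichletCharFour_apply,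
    (ZMod.natCast_eq_natCast_iff _ _ _).2 h1]
  have : n % 4 = 3 := h4
  rw [if_neg (by omega), if_neg (by omega)]
  simp

theorem prodChar_quadraticDirichletCharFourMul_ne_one (hq : q % 4 = 1)
    (hpq : p ≠ q) :
    prodChar (quadraticDirichletCharFourMul p) (quadraticDirichletCharFourMul q) ≠ 1 := by
  have hpp := (Fact.out : p.Prime)
  have hqp := (Fact.out : q.Prime)
  obtain ⟨b, hb⟩ := quadraticChar_exists_neg_one (F := ZMod q) (by
    rw [ZMod.ringChar_zmod_n]
    omega)
  have hco : Nat.Coprime (4 * p) q :=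
    Nat.Coprime.mul_left (coprime_four_of_mod_four_eq_one hq) ((Nat.coprime_primes hpp hqp).2 hpq)
  obtain ⟨n, h1, h2⟩ := Nat.chineseRemainder hco 1 b.val
  refine ne_one_of_apply_eq_neg_one (a := n) ?_
  have h4 : n % 4 = 1 := h1.of_mul_right p
  have hp1 : (n : ZMod p) = 1 := by
    simpa using (ZMod.natCast_eq_natCast_iff _ _ _).2 (h1.of_mul_left 4)
  have hq1 : (n : ZMod q) = b := by
    simpa using (ZMod.natCast_eq_natCast_iff _ _ _).2 h2
  rw [prodChar_apply, quadraticDirichletCharFourMul_apply, quadraticDirichletCharFourMul_apply,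
    dirichletCharFour_apply, hp1, hq1, if_neg (by omega), if_pos h4, quadraticDirichletChar_apply b,
    hb]
  simp

end QuadraticFamily

section Count

open Finset

theorem isQR_four_mul_iff {p : ℕ} [Fact p.Prime] (hp : p % 4 = 1) {k : ℕ}
    (hk : (k : ZMod p) ≠ 0) : IsQR p (4 * k) ↔ quadraticChar (ZMod p) k = 1 := by
  rw [quadraticChar_one_iff_isSquare hk, IsQR]
  have h2 : (2 : ZMod p) ≠ 0 := Ring.two_ne_zero (by
    rw [ZMod.ringChar_zmod_n]
    omega)
  constructor
  · rintro ⟨x, hx⟩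
    have h := (ZMod.intCast_eq_intCast_iff _ _ _).2 hx
    push_cast at h
    refine ⟨x / 2, ?_⟩
    field_simp
    rw [h]
    ring
  · rintro ⟨y, hy⟩
    refine ⟨2 * (y.val : ℤ), (ZMod.intCast_eq_intCast_iff _ _ _).1 ?_⟩
    push_cast
    rw [ZMod.natCast_zmod_val, hy]
    ring

theorem two_mul_Qcount_four {p m : ℕ} [Fact p.Prime] (hm : p = 4 * m + 1) :
    (2 * Qcount p 4 : ℤ) =
      m + ∑ i ∈ range m, quadraticChar (ZMod p) ((i + 1 : ℕ) : ZMod p) := by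
  classical
  have hne : ∀ i ∈ range m, ((i + 1 : ℕ) : ZMod p) ≠ 0 := by
    intro i hi h
    rw [mem_range] at hi
    have := Nat.le_of_dvd (Nat.succ_pos i) ((ZMod.natCast_eq_zero_iff _ _).1 h)
    omega
  have hcard : Qcount p 4 =
      #{i ∈ range m | quadraticChar (ZMod p) ((i + 1 : ℕ) : ZMod p) = 1} := by
    rw [Qcount]
    symm
    refine card_bij (fun i _ => 4 * (i + 1)) ?_ ?_ ?_
    · intro i hi
      rw [mem_filter] at hi ⊢
      have hi' := mem_range.1 hi.1
      exact ⟨mem_Icc.2 ⟨by omega, by omega⟩, dvd_mul_right _ _,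
        (isQR_four_mul_iff (by omega) (hne i hi.1)).2 hi.2⟩
    · intro i _ j _ h
      omega
    · intro a ha
      obtain ⟨ha1, ⟨k, rfl⟩, hQ⟩ := mem_filter.1 ha
      rw [mem_Icc] at ha1
      obtain ⟨i, rfl⟩ : ∃ i, k = i + 1 := ⟨k - 1, by omega⟩
      have hi : i ∈ range m := mem_range.2 (by omega)
      exact ⟨i, mem_filter.2 ⟨hi, (isQR_four_mul_iff (by omega) (hne i hi)).1 hQ⟩, rfl⟩
  rw [hcard, card_filter]
  push_cast
  have e : (m : ℤ) = ∑ i ∈ range m, 1 := by simp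
  rw [e, mul_sum, ← sum_add_distrib]
  refine sum_congr rfl fun i hi => ?_
  have h0 := hne i hi
  push_cast at h0
  rcases quadraticChar_dichotomy h0 with h | h <;> simp [h]

end Count

theorem stmt9 (ε : ℝ) (hε0 : 0 < ε) (hε : ε < 1 / 2) :
    ∃ C : ℝ, 0 < C ∧ ∀ p : ℕ, p.Prime → p % 4 = 1 →
      (Qcount p 4 : ℝ) - ((p : ℝ) - 1) / 8 ≥ C * (p : ℝ) ^ ((1 : ℝ) / 2 - ε) := by
  have hfact : ∀ i : {p : ℕ // p.Prime ∧ p % 4 = 1}, Fact (i : ℕ).Prime := fun i => ⟨i.2.1⟩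
  obtain ⟨C, hC, h⟩ := siegel (fun i : {p : ℕ // p.Prime ∧ p % 4 = 1} => 4 * (i : ℕ))
    (fun i => quadraticDirichletCharFourMul (i : ℕ))
    (fun _ => quadraticDirichletCharFourMul_isQuadratic)
    (fun i => quadraticDirichletCharFourMul_ne_one i.2.2)
    (fun i j hij => prodChar_quadraticDirichletCharFourMul_ne_one j.2.2
      fun h => hij (Subtype.ext h)) hε0 (by linarith)
  refine ⟨C * (4 : ℝ) ^ (-ε) / (2 * Real.pi), by positivity, fun p hp hp4 => ?_⟩
  have : Fact p.Prime := ⟨hp⟩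
  obtain ⟨m, hm⟩ : ∃ m, p = 4 * m + 1 := ⟨p / 4, by omega⟩
  have hp0 : (0 : ℝ) < p := by exact_mod_cast hp.pos
  have hL := h ⟨p, hp, hp4⟩
  have hS := sqrt_mul_LFunction_one_re hp4 hm (quadraticDirichletCharFourMul_ne_one hp4)
  have hQ : (2 * Qcount p 4 : ℝ) = m +
      (∑ i ∈ Finset.range m, quadraticChar (ZMod p) ((i + 1 : ℕ) : ZMod p) : ℤ) := by
    exact_mod_cast two_mul_Qcount_four hm
  have hmp : (p : ℝ) = 4 * m + 1 := by exact_mod_cast hm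
  have hQ' : (Qcount p 4 : ℝ) - ((p : ℝ) - 1) / 8 =
      Real.sqrt p * ((quadraticDirichletCharFourMul p).LFunction 1).re / (2 * Real.pi) := by
    rw [hS]
    field_simp
    linarith
  rw [hQ', ge_iff_le, sub_eq_add_neg, Real.rpow_add hp0, ← Real.sqrt_eq_rpow, div_mul_eq_mul_div]
  refine div_le_div_of_nonneg_right ?_ (by positivity)
  calc C * (4 : ℝ) ^ (-ε) * (Real.sqrt p * (p : ℝ) ^ (-ε))
      = Real.sqrt p * (C * ((4 * p : ℕ) : ℝ) ^ (-ε)) := by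
        push_cast
        rw [Real.mul_rpow (by norm_num) hp0.le]
        ring
    _ ≤ _ := by gcongr
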